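/- For a permutation π of {1,…,n} with n ≥ 4, define K_n(π) = 3 Σ_{I ⊆ {1,…,n}, |I| = 4} ψ_{τ*}(pat_I(π)), where ψ_{τ*} is the Bergsma–Dassios–Yanagimoto pattern kernel. Then for every integer n ≥ 4, (1/n!) Σ_{π ∈ S_n} K_n(π)^4 = 6·C(n,4) + (3984/5)·C(n,5) + (86562/5)·C(n,6) + (955356/7)·C(n,7) + (35817807/70)·C(n,8) + (71271603/70)·C(n,9) + (193676346/175)·C(n,10) + (108817236/175)·C(n,11) + (24762672/175)·C(n,12), where C(n,b) is the binomial coefficient with the convention C(n,b) = 0 for b > n. -/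

import Mathlib

open Finset Equiv

/-- The values of `f` at the subsets of `{0, …, k-1}`, written as the base-`2 ^ w` digits of a
single number. -/
def pack (w : ℕ) : ℕ → (Finset ℕ → ℕ) → ℕ
  | 0, f => f ∅
  | k + 1, f => pack w k f + 2 ^ (w * 2 ^ k) * pack w k fun A => f (insert k A)

theorem pack_congr {w k : ℕ} {f g : Finset ℕ → ℕ} (h : ∀ A ⊆ range k, f A = g A) :
    pack w k f = pack w k g := by
  induction k generalizing f g with
  | zero => exact h ∅ (by simp)
  | succ k ih =>
    rw [pack, pack, ih fun A hA => h A (hA.trans (range_subset_range.2 k.le_succ)),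
      ih fun A hA => h (insert k A) (by rw [range_add_one]; exact insert_subset_insert k hA)]

theorem pack_add (w k : ℕ) (f g : Finset ℕ → ℕ) :
    pack w k (fun A => f A + g A) = pack w k f + pack w k g := by
  induction k generalizing f g with
  | zero => rfl
  | succ k ih => rw [pack, pack, pack, ih, ih]; ring

theorem pack_const_mul (w k c : ℕ) (f : Finset ℕ → ℕ) :
    pack w k (fun A => c * f A) = c * pack w k f := by
  induction k generalizing f with
  | zero => rfl
  | succ k ih => rw [pack, pack, ih, ih]; ring

theorem pack_zero (w k : ℕ) : pack w k (fun _ => 0) = 0 := by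
  simpa using pack_const_mul w k 0 fun _ => 0

theorem pack_sum {ι : Type*} (w k : ℕ) (s : Finset ι) (f : ι → Finset ℕ → ℕ) :
    pack w k (fun A => ∑ i ∈ s, f i A) = ∑ i ∈ s, pack w k (f i) := by
  classical
  induction s using Finset.induction_on with
  | empty => simpa using pack_zero w k
  | insert a s ha ih =>
    rw [sum_insert ha, ← ih, ← pack_add]
    exact pack_congr fun A _ => sum_insert ha

theorem pack_lt {w k : ℕ} {f : Finset ℕ → ℕ} (h : ∀ A ⊆ range k, f A < 2 ^ w) :
    pack w k f < 2 ^ (w * 2 ^ k) := by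
  induction k generalizing f with
  | zero => simpa [pack] using h ∅ (by simp)
  | succ k ih =>
    have h₁ := ih fun A hA => h A (hA.trans (range_subset_range.2 k.le_succ))
    have h₂ := ih (f := fun A => f (insert k A)) fun A hA =>
      h (insert k A) (by rw [range_add_one]; exact insert_subset_insert k hA)
    have h₃ : 2 ^ (w * 2 ^ (k + 1)) = 2 ^ (w * 2 ^ k) * 2 ^ (w * 2 ^ k) := by
      rw [← pow_add]; congr 1; ring
    rw [pack, h₃]
    nlinarith

theorem add_two_pow_mul_land {m x y : ℕ} (a b : ℕ) (hx : x < 2 ^ m) (hy : y < 2 ^ m) :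
    (x + 2 ^ m * a) &&& (y + 2 ^ m * b) = (x &&& y) + 2 ^ m * (a &&& b) := by
  have hxy : x &&& y < 2 ^ m := lt_of_le_of_lt Nat.and_le_left hx
  refine Nat.eq_of_testBit_eq fun i => ?_
  rw [Nat.testBit_and, add_comm x, add_comm y, add_comm (x &&& y),
    Nat.testBit_two_pow_mul_add _ hx, Nat.testBit_two_pow_mul_add _ hy,
    Nat.testBit_two_pow_mul_add _ hxy]
  split <;> simp

theorem pack_land {w k : ℕ} {f : Finset ℕ → ℕ} (R : Finset ℕ → Prop) [DecidablePred R]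
    (h : ∀ A ⊆ range k, f A < 2 ^ w) :
    pack w k f &&& pack w k (fun A => if R A then 2 ^ w - 1 else 0)
      = pack w k fun A => if R A then f A else 0 := by
  induction k generalizing f R with
  | zero =>
    have := h ∅ (by simp)
    by_cases hR : R ∅ <;> simp [pack, hR, Nat.and_two_pow_sub_one_eq_mod, Nat.mod_eq_of_lt this]
  | succ k ih =>
    have h₁ : ∀ A ⊆ range k, f A < 2 ^ w :=
      fun A hA => h A (hA.trans (range_subset_range.2 k.le_succ))
    have h₂ : ∀ A ⊆ range k, f (insert k A) < 2 ^ w := fun A hA =>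
      h (insert k A) (by rw [range_add_one]; exact insert_subset_insert k hA)
    have h₃ : ∀ A ⊆ range k, (if R A then 2 ^ w - 1 else 0) < 2 ^ w := fun A _ => by
      have : 0 < 2 ^ w := by positivity
      split <;> omega
    rw [pack, pack, add_two_pow_mul_land _ _ (pack_lt h₁) (pack_lt h₃), ih R h₁,
      ih (fun A => R (insert k A)) h₂, pack]

theorem pack_shift {w k i : ℕ} (hi : i < k) (g : Finset ℕ → ℕ) :
    2 ^ (w * 2 ^ i) * pack w k (fun A => if i ∈ A then 0 else g A)
      = pack w k fun A => if i ∈ A then g (A.erase i) else 0 := by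
  induction k generalizing g with
  | zero => omega
  | succ k ih =>
    rw [pack, pack]
    rcases Nat.lt_succ_iff_lt_or_eq.1 hi with hik | rfl
    · have h₁ := ih hik g
      have h₂ := ih hik fun A => g (insert k A)
      have h₃ : pack w k (fun A => if i ∈ insert k A then 0 else g (insert k A))
          = pack w k fun A => if i ∈ A then 0 else g (insert k A) :=
        pack_congr fun A _ => by simp [hik.ne]
      have h₄ : pack w k (fun A => if i ∈ insert k A then g ((insert k A).erase i) else 0)
          = pack w k fun A => if i ∈ A then g (insert k (A.erase i)) else 0 :=
        pack_congr fun A _ => by simp [hik.ne, erase_insert_of_ne hik.ne']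
      rw [h₃, h₄, ← h₁, ← h₂]; ring
    · have hA : ∀ A ⊆ range i, i ∉ A := fun A hA h => by simpa using hA h
      rw [pack_congr (g := g) fun A h => if_neg (hA A h),
        pack_congr (g := fun _ => 0) (f := fun A => if i ∈ insert i A then 0 else g (insert i A))
          fun A _ => by simp,
        pack_congr (g := fun _ => 0) (f := fun A => if i ∈ A then g (A.erase i) else 0)
          fun A h => if_neg (hA A h),
        pack_congr (g := g)
          (f := fun A => if i ∈ insert i A then g ((insert i A).erase i) else 0)
          fun A h => by simp [erase_insert (hA A h)], pack_zero]
      ring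

theorem pack_single_range (w k c : ℕ) :
    pack w k (fun A => if A = range k then c else 0) = 2 ^ (w * (2 ^ k - 1)) * c := by
  induction k with
  | zero => simp [pack]
  | succ k ih =>
    have h₁ : pack w k (fun A => if A = range (k + 1) then c else 0) = pack w k fun _ => 0 :=
      pack_congr fun A hA => if_neg fun h => by
        have : k ∈ range k := hA (h ▸ self_mem_range_succ k)
        simp at this
    have h₂ : pack w k (fun A => if insert k A = range (k + 1) then c else 0)
        = pack w k fun A => if A = range k then c else 0 :=
      pack_congr fun A hA => by
        have hk : k ∉ A := fun h => by simpa using hA h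
        refine if_congr ⟨fun h => ?_, fun h => by rw [h, range_add_one]⟩ rfl rfl
        rw [← erase_insert hk, h, range_add_one, erase_insert notMem_range_self]
    rw [pack, h₁, h₂, pack_zero, ih, zero_add, ← mul_assoc, ← pow_add, ← mul_add]
    congr 3
    have := Nat.one_le_two_pow (n := k)
    rw [pow_succ]; omega

/-- `force n k = k n`, evaluating `n` to a literal first. -/
noncomputable def force {α : Type} (n : ℕ) (k : ℕ → α) : α :=
  Nat.rec (k 0) (fun m _ => k (Nat.succ m)) n

theorem force_eq {α : Type} (n : ℕ) (k : ℕ → α) : force n k = k n := by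
  cases n <;> rfl

/-- `forceList f l k = k l`, evaluating the entries of `l` with `f` first. -/
noncomputable def forceList {α β : Type} (f : α → (α → β) → β) (l : List α) : (List α → β) → β :=
  List.rec (motive := fun _ => (List α → β) → β) (fun k => k [])
    (fun a _ ih k => f a fun a' => ih fun l' => k (a' :: l')) l

theorem forceList_eq {α β : Type} {f : α → (α → β) → β} (hf : ∀ a k, f a k = k a) (l : List α)
    (k : List α → β) : forceList f l k = k l := by
  induction l generalizing k with
  | nil => rfl
  | cons a l ih => exact (hf a _).trans (ih _)

theorem natBeq_eq_decide (a b : ℕ) : Nat.beq a b = decide (a = b) := by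
  rw [Bool.eq_iff_iff, Nat.beq_eq, decide_eq_true_eq]

/-- The indicator, with values `0` and `2 ^ w - 1`, of the sets whose elements all satisfy `p` and
whose non-elements all satisfy `q`. -/
noncomputable def mask (w : ℕ) (p q : ℕ → Bool) : ℕ → ℕ :=
  Nat.rec (2 ^ w - 1) fun k m => force m fun m =>
    Nat.add (Bool.rec 0 m (q k)) (Bool.rec 0 (Nat.shiftLeft m (w * 2 ^ k)) (p k))

theorem mask_eq_pack (w : ℕ) (p q : ℕ → Bool) (k : ℕ) :
    mask w p q k = pack w k fun A =>
      if ∀ i ∈ range k, (i ∈ A → p i) ∧ (i ∉ A → q i) then 2 ^ w - 1 else 0 := by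
  induction k with
  | zero => simp [mask, pack]
  | succ k ih =>
    have h : mask w p q (k + 1) = (if q k then mask w p q k else 0)
        + 2 ^ (w * 2 ^ k) * (if p k then mask w p q k else 0) := by
      refine (force_eq (mask w p q k) fun m => Nat.add (Bool.rec 0 m (q k))
        (Bool.rec 0 (Nat.shiftLeft m (w * 2 ^ k)) (p k))).trans ?_
      refine congrArg₂ Nat.add ?_ ?_
      · cases q k <;> rfl
      · cases p k
        · rfl
        · exact (Nat.shiftLeft_eq _ _).trans (mul_comm _ _)
    have aux : ∀ (c : Bool) (R : Finset ℕ → Prop) [DecidablePred R],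
        (if c then pack w k (fun A => if R A then 2 ^ w - 1 else 0) else 0)
          = pack w k fun A => if c ∧ R A then 2 ^ w - 1 else 0 := by
      intro c R _
      cases c
      · simpa using (pack_zero w k).symm
      · simp
    rw [h, ih, aux, aux, pack]
    congr 1
    · refine pack_congr fun A hA => if_congr ?_ rfl rfl
      have hk : k ∉ A := fun h => by simpa using hA h
      rw [range_add_one, forall_mem_insert]
      simp [hk]
    · congr 1
      refine pack_congr fun A hA => if_congr ?_ rfl rfl
      rw [range_add_one, forall_mem_insert]
      refine and_congr (by simp) (forall₂_congr fun i hi => ?_)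
      have : i ≠ k := (mem_range.1 hi).ne
      simp [this]

/-- A rule: when the point `pt` arrives after exactly one point of `M`, the weight is multiplied
by `x` if that point is `a` and by `x ^ 2` if it is `a'`. -/
structure Rule where
  pt : ℕ
  M : List ℕ
  a : ℕ
  a' : ℕ
  x : ℕ

/-- The factor contributed by a rule when `i` arrives after the points of `A`. -/
def Rule.factor (o : Rule) (A : Finset ℕ) (i : ℕ) : ℕ :=
  if o.pt = i then
    if A ∩ o.M.toFinset = {o.a} then o.x else if A ∩ o.M.toFinset = {o.a'} then o.x ^ 2 else 1
  else 1

/-- The weight of the arrival of `i` after the points of `A`. -/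
def weight (os : List Rule) (A : Finset ℕ) (i : ℕ) : ℕ :=
  (os.map fun o => o.factor A i).prod

/-- The sum over all arrival orders of a `t`-element set of the product of the weights. -/
def orderSum (os : List Rule) : ℕ → Finset ℕ → ℕ
  | 0, _ => 1
  | t + 1, A => ∑ i ∈ A, orderSum os t (A.erase i) * weight os (A.erase i) i

/-- A compiled rule. -/
structure Op where
  pt : ℕ
  m : ℕ
  m₂ : ℕ
  x : ℕ
  x₂ : ℕ

/-- Evaluates the entries of a compiled rule. -/
noncomputable def forceOp {β : Type} (o : Op) (k : Op → β) : β :=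
  force o.pt fun i => force o.m fun a => force o.m₂ fun b => force o.x fun c => force o.x₂ fun d =>
    k ⟨i, a, b, c, d⟩

theorem forceOp_eq {β : Type} (o : Op) (k : Op → β) : forceOp o k = k o := by
  simp only [forceOp, force_eq]

/-- The mask of the sets meeting `M` in `a` only. -/
noncomputable def soleMask (w b : ℕ) (M : List ℕ) (a : ℕ) : ℕ :=
  mask w (fun k => Nat.beq k a || !(M.any (Nat.beq k))) (fun k => !(Nat.beq k a)) b

/-- Compiles a rule. -/
noncomputable def Rule.compile (w b : ℕ) (o : Rule) : Op :=
  ⟨o.pt, soleMask w b o.M o.a, soleMask w b o.M o.a', o.x - 1, o.x ^ 2 - 1⟩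

/-- Applies a compiled rule to all packed values at once. -/
def Op.app (o : Op) (U : ℕ) : ℕ :=
  Nat.add U (Nat.add (Nat.mul o.x (Nat.land U o.m)) (Nat.mul o.x₂ (Nat.land U o.m₂)))

/-- Applies the compiled rules for the point `i`. -/
noncomputable def appOps (i : ℕ) (os : List Op) : ℕ → ℕ :=
  List.rec (motive := fun _ => ℕ → ℕ) (fun U => U)
    (fun o _ ih U => Bool.rec (ih U) (force (o.app U) ih) (Nat.beq o.pt i)) os

/-- The contribution of the points below `b` to one round. -/
noncomputable def stepSum (w : ℕ) (os : List Op) (ms : List (ℕ × ℕ)) (V : ℕ) : ℕ :=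
  List.rec 0 (fun p _ ih => Nat.add ih
    (Nat.shiftLeft (force (Nat.land V p.2) (appOps p.1 os)) (w * 2 ^ p.1))) ms

/-- `t` rounds. -/
noncomputable def rounds (w : ℕ) (os : List Op) (ms : List (ℕ × ℕ)) (t : ℕ) : ℕ → ℕ :=
  Nat.rec (fun V => V) (fun _ ih V => force (stepSum w os ms V) ih) t

/-- The mask of the sets not containing `i`. -/
noncomputable def avoidMask (w b i : ℕ) : ℕ :=
  mask w (fun k => !(Nat.beq k i)) (fun _ => true) b

/-- Evaluates the entries of a pair. -/
noncomputable def forcePair {β : Type} (p : ℕ × ℕ) (k : ℕ × ℕ → β) : β :=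
  force p.1 fun a => force p.2 fun b => k (a, b)

theorem forcePair_eq {β : Type} (p : ℕ × ℕ) (k : ℕ × ℕ → β) : forcePair p k = k p := by
  simp only [forcePair, force_eq]

/-- An evaluation of `orderSum os b (range b)` that handles all subsets in parallel. -/
noncomputable def fastOrderSum (w b : ℕ) (os : List Rule) : ℕ :=
  forceList forceOp (os.map (Rule.compile w b)) fun ops =>
  forceList forcePair ((List.range b).map fun i => (i, avoidMask w b i)) fun ms =>
  Nat.shiftRight (rounds w ops ms b 1) (w * (2 ^ b - 1))

/-- The rule refers to two different points of `M`, all below `b`. -/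
def Rule.Valid (b : ℕ) (o : Rule) : Prop :=
  o.a ∈ o.M ∧ o.a' ∈ o.M ∧ o.a ≠ o.a' ∧ (∀ k ∈ o.M, k < b) ∧ 1 ≤ o.x

theorem soleMask_eq_pack {w b : ℕ} {M : List ℕ} {a : ℕ} (ha : a ∈ M) (hM : ∀ k ∈ M, k < b) :
    soleMask w b M a
      = pack w b fun A => if A ∩ M.toFinset = {a} then 2 ^ w - 1 else 0 := by
  rw [soleMask, mask_eq_pack]
  refine pack_congr fun A hA => if_congr ?_ rfl rfl
  simp only [natBeq_eq_decide, mem_range, Bool.or_eq_true, decide_eq_true_eq, Bool.not_eq_true',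
    decide_eq_false_iff_not,
    List.any_eq_false, Finset.ext_iff, mem_inter, List.mem_toFinset, mem_singleton]
  constructor
  · intro h k
    constructor
    · rintro ⟨hk, hkM⟩
      rcases (h k (hM k hkM)).1 hk with h' | h'
      · exact h'
      · exact absurd rfl (h' k hkM)
    · rintro rfl
      refine ⟨by_contra fun hk => ?_, ha⟩
      exact (h k (hM k ha)).2 hk rfl
  · intro h k hk
    refine ⟨fun hkA => ?_, fun hkA => ?_⟩
    · by_cases hkM : k ∈ M
      · exact Or.inl ((h k).1 ⟨hkA, hkM⟩)
      · exact Or.inr fun x hx hkx => hkM (hkx ▸ hx)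
    · exact fun hka => hkA ((h k).2 hka).1

theorem avoidMask_eq_pack {w b i : ℕ} (hi : i < b) :
    avoidMask w b i = pack w b fun A => if i ∉ A then 2 ^ w - 1 else 0 := by
  rw [avoidMask, mask_eq_pack]
  refine pack_congr fun A _ => if_congr ?_ rfl rfl
  constructor
  · intro h hiA
    simpa [natBeq_eq_decide] using (h i (mem_range.2 hi)).1 hiA
  · intro h k _
    refine ⟨fun hk => ?_, fun _ => rfl⟩
    have : k ≠ i := fun hki => h (hki ▸ hk)
    simpa [natBeq_eq_decide] using this

theorem Rule.Valid.one_le_factor {b : ℕ} {o : Rule} (ho : o.Valid b) (A : Finset ℕ) (i : ℕ) :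
    1 ≤ o.factor A i := by
  have := ho.2.2.2.2
  unfold Rule.factor
  split_ifs
  · exact this
  · exact Nat.one_le_pow _ _ this
  · exact le_rfl
  · exact le_rfl

theorem one_le_weight {b : ℕ} {os : List Rule} (hos : ∀ o ∈ os, o.Valid b) (A : Finset ℕ)
    (i : ℕ) : 1 ≤ weight os A i := by
  induction os with
  | nil => exact le_rfl
  | cons o os ih =>
    rw [weight, List.map_cons, List.prod_cons]
    exact Nat.mul_le_mul ((hos o (by simp)).one_le_factor A i)
      (ih fun o ho => hos o (by simp [ho]))

theorem Rule.Valid.app_pack {w b : ℕ} {o : Rule} (ho : o.Valid b) {f : Finset ℕ → ℕ}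
    (hf : ∀ A ⊆ range b, f A < 2 ^ w) :
    (o.compile w b).app (pack w b f) = pack w b fun A => f A * o.factor A o.pt := by
  obtain ⟨ha, ha', hne, hM, hx⟩ := ho
  have hx2 : 1 ≤ o.x ^ 2 := Nat.one_le_pow _ _ hx
  change pack w b f + ((o.x - 1) * (pack w b f &&& soleMask w b o.M o.a)
    + (o.x ^ 2 - 1) * (pack w b f &&& soleMask w b o.M o.a')) = _
  rw [soleMask_eq_pack ha hM, soleMask_eq_pack ha' hM, pack_land _ hf, pack_land _ hf,
    ← pack_const_mul, ← pack_const_mul, ← pack_add, ← pack_add]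
  refine pack_congr fun A _ => ?_
  simp only [Rule.factor, if_true]
  have hs : ({o.a} : Finset ℕ) ≠ {o.a'} := fun h => hne (singleton_injective h)
  by_cases h : A ∩ o.M.toFinset = {o.a}
  · simp only [h, if_true, if_neg hs]
    obtain ⟨x, hx'⟩ := Nat.exists_eq_add_of_le hx
    rw [hx']; simp; ring
  · by_cases h' : A ∩ o.M.toFinset = {o.a'}
    · simp only [h', if_true, if_neg hs.symm]
      obtain ⟨x, hx'⟩ := Nat.exists_eq_add_of_le hx2
      rw [hx']; simp; ring
    · simp [h, h']

theorem appOps_pack {w b i : ℕ} {os : List Rule} (hos : ∀ o ∈ os, o.Valid b) {f : Finset ℕ → ℕ}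
    (hf : ∀ A ⊆ range b, f A * weight os A i < 2 ^ w) :
    appOps i (os.map (Rule.compile w b)) (pack w b f)
      = pack w b fun A => f A * weight os A i := by
  induction os generalizing f with
  | nil => exact pack_congr fun A _ => (mul_one (f A)).symm
  | cons o os ih =>
    have ho := hos o (by simp)
    have hos' : ∀ o ∈ os, o.Valid b := fun o ho => hos o (by simp [ho])
    have hw : ∀ A, weight (o :: os) A i = o.factor A i * weight os A i := fun A => by
      rw [weight, List.map_cons, List.prod_cons, weight]
    have hf' : ∀ A ⊆ range b, f A * o.factor A i * weight os A i < 2 ^ w := fun A hA => by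
      rw [mul_assoc, ← hw]; exact hf A hA
    have hcons : appOps i ((o :: os).map (Rule.compile w b)) (pack w b f)
        = if o.pt = i then appOps i (os.map (Rule.compile w b)) ((o.compile w b).app (pack w b f))
          else appOps i (os.map (Rule.compile w b)) (pack w b f) := by
      change (Bool.rec (appOps i (os.map (Rule.compile w b)) (pack w b f))
        (force ((o.compile w b).app (pack w b f)) (appOps i (os.map (Rule.compile w b))))
        (Nat.beq o.pt i) : ℕ) = _
      rw [natBeq_eq_decide, force_eq]
      by_cases h : o.pt = i
      · simp [h]
      · simp [h]
    rw [hcons]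
    by_cases h : o.pt = i
    · subst h
      rw [if_pos rfl, ho.app_pack fun A hA => lt_of_le_of_lt
        (Nat.le_mul_of_pos_right _ (one_le_weight hos A _)) (hf A hA), ih hos' hf']
      exact pack_congr fun A _ => by rw [hw, mul_assoc]
    · have hfac : ∀ A, o.factor A i = 1 := fun A => if_neg h
      simp only [hfac, mul_one] at hf'
      rw [if_neg h, ih hos' hf']
      exact pack_congr fun A _ => by rw [hw, hfac, one_mul]

theorem stepSum_eq (w : ℕ) (os : List Op) (ms : List (ℕ × ℕ)) (V : ℕ) :
    stepSum w os ms V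
      = (ms.map fun p => 2 ^ (w * 2 ^ p.1) * appOps p.1 os (V &&& p.2)).sum := by
  induction ms with
  | nil => rfl
  | cons p ms ih =>
    rw [List.map_cons, List.sum_cons, ← ih, add_comm]
    change _ + Nat.shiftLeft (force _ _) _ = _
    rw [force_eq]
    congr 1
    exact (Nat.shiftLeft_eq _ _).trans (mul_comm _ _)

theorem orderSum_mul_weight_le (os : List Rule) {t : ℕ} {A : Finset ℕ} {i : ℕ} (hi : i ∉ A) :
    orderSum os t A * weight os A i ≤ orderSum os (t + 1) (insert i A) := by
  have := single_le_sum
    (f := fun i' => orderSum os t ((insert i A).erase i') * weight os ((insert i A).erase i') i')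
    (fun _ _ => Nat.zero_le _) (mem_insert_self i A)
  simp only [erase_insert hi] at this
  exact this

theorem orderSum_le_orderSum_range {b : ℕ} {os : List Rule} (hos : ∀ o ∈ os, o.Valid b)
    {A : Finset ℕ} (hA : A ⊆ range b) :
    orderSum os #A A ≤ orderSum os b (range b) := by
  induction h : b - #A generalizing A with
  | zero =>
    have hc := card_le_card hA
    rw [card_range] at hc
    have : A = range b := eq_of_subset_of_card_le hA (by rw [card_range]; omega)
    rw [this, card_range]
  | succ m ih =>
    obtain ⟨i, hi, hiA⟩ : ∃ i ∈ range b, i ∉ A := by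
      by_contra! hcon
      have := card_le_card hcon
      rw [card_range] at this
      omega
    have h₁ := ih (A := insert i A) (insert_subset hi hA) (by rw [card_insert_of_notMem hiA]; omega)
    rw [card_insert_of_notMem hiA] at h₁
    exact (Nat.le_mul_of_pos_right _ (one_le_weight hos A i)).trans
      ((orderSum_mul_weight_le os hiA).trans h₁)

theorem sum_range_eq_list (b : ℕ) (f : ℕ → ℕ) :
    ∑ i ∈ range b, f i = ((List.range b).map f).sum := by
  induction b with
  | zero => rfl
  | succ b ih => rw [sum_range_succ, ih, List.range_succ]; simp

theorem stepSum_pack {w b t : ℕ} {os : List Rule} (hos : ∀ o ∈ os, o.Valid b)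
    (hw : orderSum os b (range b) < 2 ^ w) :
    stepSum w (os.map (Rule.compile w b)) ((List.range b).map fun i => (i, avoidMask w b i))
        (pack w b fun A => if #A = t then orderSum os t A else 0)
      = pack w b fun A => if #A = t + 1 then orderSum os (t + 1) A else 0 := by
  rw [stepSum_eq, List.map_map, ← sum_range_eq_list]
  trans ∑ i ∈ range b, pack w b fun A => if i ∈ A then
      if #A = t + 1 then orderSum os t (A.erase i) * weight os (A.erase i) i else 0 else 0
  · refine sum_congr rfl fun i hi => ?_
    have hib := mem_range.1 hi
    have hlt : ∀ A ⊆ range b, (if #A = t then orderSum os t A else 0) < 2 ^ w := fun A hA => by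
      split_ifs with h
      · subst h
        exact lt_of_le_of_lt (orderSum_le_orderSum_range hos hA) hw
      · positivity
    simp only [Function.comp]
    rw [avoidMask_eq_pack hib, pack_land _ hlt, appOps_pack hos fun A hA => ?_,
      pack_congr (g := fun A => if i ∈ A then 0 else
        if #A = t then orderSum os t A * weight os A i else 0) fun A _ => ?_, pack_shift hib]
    · refine pack_congr fun A _ => ?_
      split_ifs with h₁ h₂ h₃ h₃
      · rfl
      · rw [card_erase_of_mem h₁] at h₂; have := card_pos.2 ⟨i, h₁⟩; omega
      · rw [card_erase_of_mem h₁] at h₂; omega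
      · rfl
      · rfl
    · by_cases hiA : i ∈ A <;> by_cases hc : #A = t <;> simp [hiA, hc]
    · by_cases hiA : i ∈ A
      · simp [hiA]
      · by_cases hc : #A = t
        · simp only [hiA, hc, not_false_iff, if_true]
          subst hc
          refine lt_of_le_of_lt ((orderSum_mul_weight_le os hiA).trans ?_) hw
          rw [← card_insert_of_notMem hiA]
          exact orderSum_le_orderSum_range hos (insert_subset hi hA)
        · simp [hc]
  · rw [← pack_sum]
    refine pack_congr fun A hA => ?_
    by_cases hc : #A = t + 1
    · simp only [hc, if_true, orderSum]
      rw [← sum_filter]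
      congr 1
      ext i
      simp only [mem_filter]
      exact ⟨fun h => h.2, fun h => ⟨hA h, h⟩⟩
    · simp [hc]

theorem rounds_pack {w b : ℕ} {os : List Rule} (hos : ∀ o ∈ os, o.Valid b)
    (hw : orderSum os b (range b) < 2 ^ w) (s t : ℕ) :
    rounds w (os.map (Rule.compile w b)) ((List.range b).map fun i => (i, avoidMask w b i)) s
        (pack w b fun A => if #A = t then orderSum os t A else 0)
      = pack w b fun A => if #A = t + s then orderSum os (t + s) A else 0 := by
  induction s generalizing t with
  | zero => rfl
  | succ s ih =>
    refine (force_eq _ _).trans ?_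
    rw [stepSum_pack hos hw]
    refine (ih (t + 1)).trans ?_
    rw [add_right_comm, add_assoc]

theorem fastOrderSum_eq {w b : ℕ} {os : List Rule} (hos : ∀ o ∈ os, o.Valid b)
    (hw : orderSum os b (range b) < 2 ^ w) :
    fastOrderSum w b os = orderSum os b (range b) := by
  have h₀ : ∀ k, pack w k (fun A => if #A = 0 then orderSum os 0 A else 0) = 1 := by
    intro k
    induction k with
    | zero => rfl
    | succ k ih =>
      rw [pack, ih, pack_congr (g := fun _ => 0) (f := fun A => if #(insert k A) = 0 then _ else 0)
        fun A _ => if_neg (by simp), pack_zero]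
      rfl
  have h₁ := rounds_pack hos hw b 0
  rw [h₀, zero_add] at h₁
  rw [fastOrderSum, forceList_eq forceOp_eq, forceList_eq forcePair_eq, h₁]
  rw [pack_congr (g := fun A => if A = range b then orderSum os b (range b) else 0) fun A hA => ?_,
    pack_single_range]
  · refine (Nat.shiftRight_eq_div_pow _ _).trans (Nat.mul_div_cancel_left _ (by positivity))
  · by_cases hc : #A = b
    · have : A = range b := eq_of_subset_of_card_le hA (by rw [card_range, hc])
      subst this; simp
    · rw [if_neg hc, if_neg fun h => hc (by rw [h, card_range])]

/-- The product of the weights along an arrival order, latest arrival first. -/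
def listWeight (os : List Rule) : List ℕ → ℕ
  | [] => 1
  | i :: l => listWeight os l * weight os l.toFinset i

/-- The lists enumerating a finite set without repetition. -/
def arrivals (A : Finset ℕ) : Finset (List ℕ) :=
  ⟨A.val.lists, Multiset.lists_nodup_finset A⟩

theorem mem_arrivals {A : Finset ℕ} {l : List ℕ} :
    l ∈ arrivals A ↔ l.Nodup ∧ l.toFinset = A := by
  refine (Multiset.mem_lists_iff A.val l).trans ?_
  constructor
  · intro h
    have hn : l.Nodup := by
      have := A.nodup
      rw [h] at this
      exact Multiset.coe_nodup.1 this
    refine ⟨hn, ?_⟩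
    rw [← Finset.val_inj, h]
    exact Multiset.dedup_eq_self.2 (Multiset.coe_nodup.2 hn)
  · rintro ⟨hn, rfl⟩
    exact Multiset.dedup_eq_self.2 (Multiset.coe_nodup.2 hn)

theorem orderSum_eq_sum_arrivals (os : List Rule) {t : ℕ} {A : Finset ℕ} (hA : #A = t) :
    orderSum os t A = ∑ l ∈ arrivals A, listWeight os l := by
  induction t generalizing A with
  | zero =>
    rw [card_eq_zero] at hA
    subst hA
    have : arrivals ∅ = {[]} := by
      ext l
      rw [mem_arrivals, mem_singleton]
      exact ⟨fun h => by simpa using h.2, fun h => by simp [h]⟩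
    rw [this]
    simp [orderSum, listWeight]
  | succ t ih =>
    rw [orderSum]
    have h : ∀ i ∈ A, orderSum os t (A.erase i) * weight os (A.erase i) i
        = ∑ l ∈ arrivals (A.erase i), listWeight os (i :: l) := fun i hi => by
      rw [ih (by rw [card_erase_of_mem hi, hA]; rfl), sum_mul]
      refine sum_congr rfl fun l hl => ?_
      rw [listWeight, (mem_arrivals.1 hl).2]
    rw [sum_congr rfl h, sum_sigma']
    refine sum_bij (fun p _ => p.1 :: p.2) ?_ ?_ ?_ ?_
    · rintro ⟨i, l⟩ hp
      simp only [mem_sigma, mem_arrivals] at hp ⊢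
      have hil : i ∉ l := fun hil => by
        have : i ∈ A.erase i := hp.2.2 ▸ List.mem_toFinset.2 hil
        simp at this
      refine ⟨List.nodup_cons.2 ⟨hil, hp.2.1⟩, ?_⟩
      rw [List.toFinset_cons, hp.2.2, insert_erase hp.1]
    · rintro ⟨i, l⟩ _ ⟨i', l'⟩ _ h
      simpa using h
    · intro l hl
      obtain ⟨hn, rfl⟩ := mem_arrivals.1 hl
      cases l with
      | nil => simp at hA
      | cons i l =>
        refine ⟨⟨i, l⟩, ?_, rfl⟩
        rw [List.nodup_cons] at hn
        simp only [mem_sigma, mem_arrivals]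
        refine ⟨by simp, hn.2, ?_⟩
        rw [List.toFinset_cons, erase_insert (by simpa using hn.1)]
    · intro p _
      rfl

theorem listWeight_append (os os' : List Rule) (l : List ℕ) :
    listWeight (os ++ os') l = listWeight os l * listWeight os' l := by
  induction l with
  | nil => rfl
  | cons i l ih =>
    simp only [listWeight, ih, weight, List.map_append, List.prod_append]
    ring

theorem listWeight_nil (l : List ℕ) : listWeight [] l = 1 := by
  induction l with
  | nil => rfl
  | cons i l ih => simp [listWeight, ih, weight]

/-- The rules that weight an arrival order by `x ^ label`, the label being determined by the two
points of `M` arriving first. -/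
def pairRules (x : ℕ) : List ℕ → List Rule
  | [a, b, c, d] => [⟨a, [a, b, c, d], c, d, x⟩, ⟨b, [a, b, c, d], d, c, x⟩,
      ⟨c, [a, b, c, d], a, b, x⟩, ⟨d, [a, b, c, d], b, a, x⟩]
  | _ => []

/-- The first two numbers are separated from the last two. -/
def Separated (p q r s : ℕ) : Prop :=
  (p < r ∧ p < s ∧ q < r ∧ q < s) ∨ (r < p ∧ r < q ∧ s < p ∧ s < q)

instance (p q r s : ℕ) : Decidable (Separated p q r s) :=
  inferInstanceAs (Decidable (_ ∨ _))

/-- The label in `{0, 1, 2}` of the pairing of four numbers into two small and two large ones. -/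
def label (p q r s : ℕ) : ℕ :=
  if Separated p q r s then 0 else if Separated p r q s then 1 else 2

theorem listWeight_filter {os : List Rule} {M : List ℕ}
    (hM : ∀ o ∈ os, o.M = M) (hpt : ∀ o ∈ os, o.pt ∈ M) (l : List ℕ) :
    listWeight os l = listWeight os (l.filter (· ∈ M)) := by
  have hw : ∀ (A : Finset ℕ) (i : ℕ), weight os A i = weight os (A ∩ M.toFinset) i :=
    fun A i => by
      refine congrArg List.prod (List.map_congr_left fun o ho => ?_)
      simp only [Rule.factor, hM o ho, inter_assoc, inter_self]
  have hf : ∀ l : List ℕ, (l.filter (· ∈ M)).toFinset = l.toFinset ∩ M.toFinset := fun l => by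
    ext k
    simp
  induction l with
  | nil => rfl
  | cons i l ih =>
    by_cases hi : i ∈ M
    · rw [List.filter_cons_of_pos (by simpa using hi), listWeight, listWeight, ← ih, hf, ← hw]
    · rw [List.filter_cons_of_neg (by simpa using hi), listWeight, ← ih, weight]
      have : ∀ o ∈ os, o.factor l.toFinset i = 1 := fun o ho =>
        if_neg fun h : o.pt = i => hi (h ▸ hpt o ho)
      rw [List.map_congr_left this]
      simp

theorem weight_eq_one_of_card {os : List Rule} {A : Finset ℕ} (i : ℕ)
    (hA : ∀ o ∈ os, #(A ∩ o.M.toFinset) ≠ 1) : weight os A i = 1 := by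
  have : ∀ o ∈ os, o.factor A i = 1 := fun o ho => by
    have h₁ : A ∩ o.M.toFinset ≠ {o.a} := fun h => hA o ho (by rw [h, card_singleton])
    have h₂ : A ∩ o.M.toFinset ≠ {o.a'} := fun h => hA o ho (by rw [h, card_singleton])
    simp [Rule.factor, h₁, h₂]
  rw [weight, List.map_congr_left this]
  simp

theorem listWeight_four {os : List Rule} {M : List ℕ} (hM : ∀ o ∈ os, o.M = M)
    {p q r s : ℕ} (hn : [s, r, q, p].Nodup) (hsub : ∀ k ∈ [s, r, q, p], k ∈ M) :
    listWeight os [s, r, q, p] = weight os {p} q := by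
  have hp := hsub p (by simp)
  have hq := hsub q (by simp)
  have hr := hsub r (by simp)
  simp only [List.nodup_cons, List.mem_cons, not_or] at hn
  have h₀ : weight os (∅ : Finset ℕ) p = 1 := weight_eq_one_of_card _ fun o ho => by simp
  have h₂ : weight os {q, p} r = 1 := weight_eq_one_of_card _ fun o ho => by
    rw [hM o ho, inter_eq_left.2 (by intro k; simp; rintro (rfl | rfl) <;> assumption),
      card_pair hn.2.2.1.1]
    decide
  have h₃ : weight os {r, q, p} s = 1 := weight_eq_one_of_card _ fun o ho => by
    rw [hM o ho, inter_eq_left.2 (by intro k; simp; rintro (rfl | rfl | rfl) <;> assumption),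
      card_insert_of_notMem (by simp; tauto), card_pair hn.2.2.1.1]
    decide
  simp only [listWeight, List.toFinset_cons, List.toFinset_nil, insert_empty_eq, h₀, h₂, h₃,
    one_mul, mul_one]

theorem listWeight_pairRules {x a b c d : ℕ} (hn : [a, b, c, d].Nodup) {v : ℕ → ℕ} {l : List ℕ}
    (hl : l.Pairwise fun i k => v k < v i) (hsub : [a, b, c, d] ⊆ l) :
    listWeight (pairRules x [a, b, c, d]) l = x ^ label (v a) (v b) (v c) (v d) := by
  have hM : ∀ o ∈ pairRules x [a, b, c, d], o.M = [a, b, c, d] := by simp [pairRules]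
  rw [listWeight_filter hM (by simp [pairRules])]
  have hl' := hl.filter (· ∈ [a, b, c, d])
  have hperm : (l.filter (· ∈ [a, b, c, d])).Perm [a, b, c, d] := by
    rw [List.perm_ext_iff_of_nodup (hl'.imp fun {i k} h => by rintro rfl; exact lt_irrefl _ h) hn]
    intro k
    rw [List.mem_filter, decide_eq_true_eq]
    exact ⟨fun h => h.2, fun h => ⟨hsub h, h⟩⟩
  generalize l.filter (· ∈ [a, b, c, d]) = m at hl' hperm
  have hlen := hperm.length_eq
  match m, hlen with
  | [s, r, q, p], _ =>
    rw [listWeight_four hM (hperm.nodup_iff.2 hn) fun k hk => hperm.subset hk]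
    have hvalues : v p < v q ∧ v q < v r ∧ v r < v s := by
      simp only [List.pairwise_cons, List.mem_cons] at hl'
      exact ⟨hl'.2.2.1 p (by simp), hl'.2.1 q (by simp), hl'.1 r (by simp)⟩
    simp only [List.nodup_cons, List.mem_cons, not_or, List.not_mem_nil, not_false_eq_true,
      and_true, List.nodup_nil] at hn
    obtain ⟨⟨hab, hac, had⟩, ⟨hbc, hbd⟩, hcd⟩ := hn
    have hba := Ne.symm hab
    have hca := Ne.symm hac
    have hda := Ne.symm had
    have hcb := Ne.symm hbc
    have hdb := Ne.symm hbd
    have hdc := Ne.symm hcd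
    have hinter : ∀ k ∈ [a, b, c, d], ({k} : Finset ℕ) ∩ [a, b, c, d].toFinset = {k} :=
      fun k hk => inter_eq_left.2 (by simpa using hk)
    have hp := hinter p (hperm.subset (by simp))
    rw [← List.mem_permutations] at hperm
    simp only [weight, pairRules, Rule.factor, List.map_cons, List.map_nil, List.prod_cons,
      List.prod_nil, hp, singleton_inj]
    clear hsub hl hl' hM hlen hinter hp
    obtain ⟨h₁, h₂, h₃⟩ := hvalues
    simp [List.permutations, List.permutationsAux, List.permutationsAux.rec,
      List.permutationsAux2] at hperm
    rcases hperm with hperm | hperm | hperm | hperm | hperm | hperm | hperm | hperm | hperm |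
        hperm | hperm | hperm | hperm | hperm | hperm | hperm | hperm | hperm | hperm | hperm |
        hperm | hperm | hperm | hperm <;>
      obtain ⟨rfl, rfl, rfl, rfl⟩ := hperm <;>
      simp only [*, if_true, if_false, mul_one, one_mul] <;>
      unfold label <;> split_ifs <;>
      first | (exfalso; unfold Separated at *; omega) | simp

/-- The extension by zero of a permutation of `Fin n` to `ℕ`. -/
def extend {n : ℕ} (π : Perm (Fin n)) (i : ℕ) : ℕ :=
  if h : i < n then (π ⟨i, h⟩ : ℕ) else 0

theorem extend_val {n : ℕ} (π : Perm (Fin n)) (i : Fin n) : extend π i = π i := by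
  simp [extend]

/-- The points in decreasing order of their values. -/
def descending {n : ℕ} (π : Perm (Fin n)) : List ℕ :=
  List.ofFn fun k : Fin n => (π⁻¹ k.rev : ℕ)

theorem descending_pairwise {n : ℕ} (π : Perm (Fin n)) :
    (descending π).Pairwise fun i k => extend π k < extend π i := by
  rw [descending, List.pairwise_ofFn]
  intro i j hij
  rw [extend_val, extend_val, show π (π⁻¹ j.rev) = j.rev from π.apply_symm_apply _,
    show π (π⁻¹ i.rev) = i.rev from π.apply_symm_apply _]
  exact Fin.rev_lt_rev.2 hij

theorem mem_descending {n : ℕ} (π : Perm (Fin n)) (i : ℕ) : i ∈ descending π ↔ i < n := by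
  rw [descending, List.mem_ofFn]
  constructor
  · rintro ⟨k, rfl⟩
    exact Fin.is_lt _
  · intro h
    exact ⟨(π ⟨i, h⟩).rev, by simp⟩

theorem sum_arrivals_range {n : ℕ} (F : List ℕ → ℕ) :
    ∑ l ∈ arrivals (range n), F l = ∑ π : Perm (Fin n), F (descending π) := by
  symm
  refine sum_bij (fun π _ => descending π) ?_ ?_ ?_ fun _ _ => rfl
  · intro π _
    rw [mem_arrivals]
    refine ⟨(descending_pairwise π).imp fun {i k} h => by rintro rfl; exact lt_irrefl _ h, ?_⟩
    ext i
    rw [List.mem_toFinset, mem_descending, mem_range]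
  · intro π _ π' _ h
    have h' := List.ofFn_injective h
    have : π⁻¹ = π'⁻¹ := Equiv.ext fun k => by
      have := congrFun h' k.rev
      rw [Fin.rev_rev] at this
      exact Fin.ext this
    exact inv_injective this
  · intro l hl
    obtain ⟨hn, hl⟩ := mem_arrivals.1 hl
    have hlen : l.length = n := by
      rw [← List.toFinset_card_of_nodup hn, hl, card_range]
    subst hlen
    have hlt : ∀ k : Fin l.length, l[k] < l.length := fun k => by
      rw [← mem_range, ← hl, List.mem_toFinset]
      exact List.getElem_mem _
    have hinj : Function.Injective fun k : Fin l.length => (⟨l[k], hlt k⟩ : Fin l.length) := by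
      intro i k h
      have := (hn.getElem_inj_iff (hi := i.2) (hj := k.2)).1 (Fin.ext_iff.1 h)
      exact Fin.ext this
    refine ⟨(Fin.revPerm.trans (Equiv.ofBijective _ (Finite.injective_iff_bijective.1 hinj)))⁻¹,
      mem_univ _, ?_⟩
    rw [descending, inv_inv]
    refine List.ext_getElem (by simp) fun i h₁ h₂ => ?_
    simp

/-- The rules for several four-element lists, the label of the `j`-th being a base-three digit. -/
def digitRules (β : ℕ) : ℕ → List (List ℕ) → List Rule
  | _, [] => []
  | j, M :: Ms => pairRules (2 ^ (β * 3 ^ j)) M ++ digitRules β (j + 1) Ms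

/-- The label of a list of four points. -/
def listLabel (v : ℕ → ℕ) : List ℕ → ℕ
  | [a, b, c, d] => label (v a) (v b) (v c) (v d)
  | _ => 0

/-- The number whose base-three digits, from the `j`-th on, are the labels of the lists. -/
def labelCode (v : ℕ → ℕ) : ℕ → List (List ℕ) → ℕ
  | _, [] => 0
  | j, M :: Ms => 3 ^ j * listLabel v M + labelCode v (j + 1) Ms

theorem listWeight_digitRules {β b : ℕ} {π : Perm (Fin b)} {Ms : List (List ℕ)}
    (hlen : ∀ M ∈ Ms, M.length = 4) (hn : ∀ M ∈ Ms, M.Nodup) (hb : ∀ M ∈ Ms, ∀ k ∈ M, k < b)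
    (j : ℕ) :
    listWeight (digitRules β j Ms) (descending π) = 2 ^ (β * labelCode (extend π) j Ms) := by
  induction Ms generalizing j with
  | nil => simp [digitRules, labelCode, listWeight_nil]
  | cons M Ms ih =>
    rw [digitRules, listWeight_append, ih (fun M h => hlen M (by simp [h]))
      (fun M h => hn M (by simp [h])) (fun M h => hb M (by simp [h]))]
    have hM := hlen M (by simp)
    match M, hM with
    | [a, b', c, d], _ =>
      rw [listWeight_pairRules (hn _ (by simp)) (descending_pairwise π)
        fun k hk => (mem_descending π k).2 (hb _ (by simp) k hk), labelCode, listLabel, ← pow_mul,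
        ← pow_add]
      ring_nf

theorem orderSum_digitRules {β b : ℕ} {Ms : List (List ℕ)}
    (hlen : ∀ M ∈ Ms, M.length = 4) (hn : ∀ M ∈ Ms, M.Nodup) (hb : ∀ M ∈ Ms, ∀ k ∈ M, k < b) :
    orderSum (digitRules β 0 Ms) b (range b)
      = ∑ π : Perm (Fin b), 2 ^ (β * labelCode (extend π) 0 Ms) := by
  rw [orderSum_eq_sum_arrivals _ (card_range b), sum_arrivals_range]
  exact sum_congr rfl fun π _ => listWeight_digitRules hlen hn hb 0

theorem digitRules_valid {β b : ℕ} {Ms : List (List ℕ)}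
    (hn : ∀ M ∈ Ms, M.Nodup) (hb : ∀ M ∈ Ms, ∀ k ∈ M, k < b) (j : ℕ) :
    ∀ o ∈ digitRules β j Ms, o.Valid b := by
  induction Ms generalizing j with
  | nil => simp [digitRules]
  | cons M Ms ih =>
    intro o ho
    rw [digitRules, List.mem_append] at ho
    rcases ho with ho | ho
    · have hn' := hn M (by simp)
      have hb' := hb M (by simp)
      unfold pairRules at ho
      split at ho
      · have hx : 1 ≤ 2 ^ (β * 3 ^ j) := Nat.one_le_two_pow
        simp only [List.nodup_cons, List.mem_cons, not_or, List.not_mem_nil, not_false_eq_true,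
          and_true, List.nodup_nil] at hn'
        simp only [List.mem_cons, List.not_mem_nil, or_false] at ho
        rcases ho with rfl | rfl | rfl | rfl
        · exact ⟨by simp, by simp, hn'.2.2, hb', hx⟩
        · exact ⟨by simp, by simp, Ne.symm hn'.2.2, hb', hx⟩
        · exact ⟨by simp, by simp, hn'.1.1, hb', hx⟩
        · exact ⟨by simp, by simp, Ne.symm hn'.1.1, hb', hx⟩
      · simp at ho
    · exact ih (fun M h => hn M (by simp [h])) (fun M h => hb M (by simp [h])) (j + 1) o ho

theorem listLabel_lt_three (v : ℕ → ℕ) (M : List ℕ) : listLabel v M < 3 := by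
  unfold listLabel
  split
  · unfold label
    split_ifs <;> decide
  · decide

/-- The kernel on labels. -/
def agree (p q : ℕ) : ℤ := if p = q then 2 else -1

/-- The product of the kernels of the first `d` base-three digits. -/
def digitKernel : ℕ → ℕ → ℕ → ℤ
  | 0, _, _ => 1
  | d + 1, p, q => agree (p / 3 ^ d) (q / 3 ^ d) * digitKernel d (p % 3 ^ d) (q % 3 ^ d)

/-- The quadratic form of `digitKernel`, evaluated at the base-`B` digits of a number. -/
noncomputable def digitForm (B d : ℕ) : ℕ → ℤ :=
  Nat.rec (motive := fun _ => ℕ → ℤ) (fun a => Int.ofNat (Nat.mul a a))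
    (fun d ih a => force (B ^ 3 ^ d) fun w =>
      force (a % w) fun a₀ => force (a / w % w) fun a₁ => force (a / w / w) fun a₂ =>
      3 * (ih a₀ + ih a₁ + ih a₂) - ih (a₀ + a₁ + a₂)) d

theorem digitForm_succ (B d a : ℕ) :
    digitForm B (d + 1) a
      = 3 * (digitForm B d (a % B ^ 3 ^ d) + digitForm B d (a / B ^ 3 ^ d % B ^ 3 ^ d)
          + digitForm B d (a / B ^ 3 ^ d / B ^ 3 ^ d))
        - digitForm B d (a % B ^ 3 ^ d + a / B ^ 3 ^ d % B ^ 3 ^ d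
          + a / B ^ 3 ^ d / B ^ 3 ^ d) := by
  simp only [digitForm, force_eq]

theorem sum_pow_lt {ι : Type*} {B m : ℕ} {s : Finset ι} {p : ι → ℕ} (hs : #s < B)
    (hp : ∀ i ∈ s, p i < m) : ∑ i ∈ s, B ^ p i < B ^ m := by
  rcases s.eq_empty_or_nonempty with rfl | ⟨i, hi⟩
  · have : 0 < B := by omega
    simp only [sum_empty]
    positivity
  · obtain ⟨m, rfl⟩ : ∃ m', m = m' + 1 := ⟨m - 1, by have := hp i hi; omega⟩
    calc ∑ i ∈ s, B ^ p i ≤ ∑ _i ∈ s, B ^ m := sum_le_sum fun i hi =>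
          Nat.pow_le_pow_right (by omega) (by have := hp i hi; omega)
      _ = #s * B ^ m := by simp
      _ < B * B ^ m := Nat.mul_lt_mul_of_pos_right hs (Nat.pow_pos (by omega))
      _ = B ^ (m + 1) := by rw [pow_succ, mul_comm]

theorem digitForm_sum {ι : Type*} [DecidableEq ι] {B : ℕ} (d : ℕ) {s : Finset ι} {p : ι → ℕ}
    (hs : #s < B) (hp : ∀ i ∈ s, p i < 3 ^ d) :
    digitForm B d (∑ i ∈ s, B ^ p i) = ∑ i ∈ s, ∑ k ∈ s, digitKernel d (p i) (p k) := by
  induction d generalizing s p with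
  | zero =>
    have h : ∀ i ∈ s, B ^ p i = 1 := fun i hi => by
      have := hp i hi
      rw [show p i = 0 by omega, pow_zero]
    rw [sum_congr rfl h]
    simp [digitForm, digitKernel]
  | succ d ih =>
    set w := B ^ 3 ^ d with hw
    have h3 : 0 < 3 ^ d := by positivity
    have hmod : ∀ i, p i % 3 ^ d < 3 ^ d := fun i => Nat.mod_lt _ h3
    let part : ℕ → Finset ι := fun t => s.filter fun i => p i / 3 ^ d = t
    have hpart : ∀ t, #(part t) < B := fun t => lt_of_le_of_lt (card_filter_le _ _) hs
    let y : ℕ → ℕ := fun t => ∑ i ∈ part t, B ^ (p i % 3 ^ d)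
    have hy : ∀ t, y t < w := fun t => sum_pow_lt (hpart t) fun i _ => hmod i
    have hdig : ∀ i ∈ s, p i / 3 ^ d ∈ range 3 := fun i hi => by
      rw [mem_range, Nat.div_lt_iff_lt_mul h3, mul_comm, ← pow_succ]
      exact hp i hi
    have hsplit : ∀ F : ι → ℕ, ∑ i ∈ s, F i
        = ∑ i ∈ part 0, F i + ∑ i ∈ part 1, F i + ∑ i ∈ part 2, F i := fun F => by
      rw [← sum_fiberwise_of_maps_to hdig, sum_range_succ, sum_range_succ, sum_range_one]
    have hsplit' : ∀ F : ι → ℤ, ∑ i ∈ s, F i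
        = ∑ i ∈ part 0, F i + ∑ i ∈ part 1, F i + ∑ i ∈ part 2, F i := fun F => by
      rw [← sum_fiberwise_of_maps_to hdig, sum_range_succ, sum_range_succ, sum_range_one]
    have hpow : ∀ t, ∑ i ∈ part t, B ^ p i = w ^ t * y t := fun t => by
      rw [mul_sum]
      refine sum_congr rfl fun i hi => ?_
      rw [hw, ← pow_mul, ← pow_add, ← (mem_filter.1 hi).2, Nat.div_add_mod]
    have hval : ∑ i ∈ s, B ^ p i = y 0 + w * (y 1 + w * y 2) := by
      rw [hsplit, hpow, hpow, hpow]; ring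
    have hwpos : 0 < w := lt_of_le_of_lt (Nat.zero_le _) (hy 0)
    have e₀ : (y 0 + w * (y 1 + w * y 2)) % w = y 0 := by
      rw [Nat.add_mul_mod_self_left, Nat.mod_eq_of_lt (hy 0)]
    have e₁ : (y 0 + w * (y 1 + w * y 2)) / w = y 1 + w * y 2 := by
      rw [Nat.add_mul_div_left _ _ hwpos, Nat.div_eq_of_lt (hy 0), zero_add]
    have e₂ : (y 1 + w * y 2) % w = y 1 := by
      rw [Nat.add_mul_mod_self_left, Nat.mod_eq_of_lt (hy 1)]
    have e₃ : (y 1 + w * y 2) / w = y 2 := by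
      rw [Nat.add_mul_div_left _ _ hwpos, Nat.div_eq_of_lt (hy 1), zero_add]
    have hall : y 0 + y 1 + y 2 = ∑ i ∈ s, B ^ (p i % 3 ^ d) := (hsplit _).symm
    have hform : ∀ t, digitForm B d (y t)
        = ∑ i ∈ part t, ∑ k ∈ part t, digitKernel d (p i % 3 ^ d) (p k % 3 ^ d) := fun t =>
      ih (p := fun i => p i % 3 ^ d) (hpart t) fun i _ => hmod i
    rw [hval, digitForm_succ, ← hw, e₀, e₁, e₂, e₃, hall, hform, hform, hform,
      ih (p := fun i => p i % 3 ^ d) hs fun i _ => hmod i]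
    have hone : ∀ t, ∑ i ∈ part t, ∑ k ∈ part t, digitKernel d (p i % 3 ^ d) (p k % 3 ^ d)
        = ∑ i ∈ part t, ∑ k ∈ s, if p i / 3 ^ d = p k / 3 ^ d then
          digitKernel d (p i % 3 ^ d) (p k % 3 ^ d) else 0 := fun t =>
      sum_congr rfl fun i hi => by
        rw [sum_filter]
        refine sum_congr rfl fun k _ => if_congr ?_ rfl rfl
        rw [(mem_filter.1 hi).2, eq_comm]
    rw [hone, hone, hone, ← hsplit', mul_sum, ← sum_sub_distrib]
    refine sum_congr rfl fun i _ => ?_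
    rw [mul_sum, ← sum_sub_distrib]
    refine sum_congr rfl fun k _ => ?_
    rw [digitKernel, agree]
    split_ifs <;> ring

/-- The positions of the letters of a word that have the `j`-th bit. -/
def members (l : List ℕ) (j : ℕ) : List ℕ :=
  (List.range l.length).filter fun i => Nat.testBit (l.getD i 0) j

/-- The sum of the products of the four kernels over all pairs of permutations of the positions
of a word, in a form that evaluates quickly. -/
noncomputable def wordValue (l : List ℕ) : ℤ :=
  force (Nat.log2 (Nat.factorial l.length) + 1) fun β =>
  force (l.length) fun b =>
  forceList (forceList force) [members l 0, members l 1, members l 2, members l 3] fun Ms =>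
  force (fastOrderSum (81 * β) b (digitRules β 0 Ms)) (digitForm (2 ^ β) 4)

theorem digitKernel_labelCode (v v' : ℕ → ℕ) (M₀ M₁ M₂ M₃ : List ℕ) :
    digitKernel 4 (labelCode v 0 [M₀, M₁, M₂, M₃]) (labelCode v' 0 [M₀, M₁, M₂, M₃])
      = agree (listLabel v M₀) (listLabel v' M₀) * agree (listLabel v M₁) (listLabel v' M₁)
        * agree (listLabel v M₂) (listLabel v' M₂) * agree (listLabel v M₃) (listLabel v' M₃) := by
  have h₀ := listLabel_lt_three v M₀
  have h₁ := listLabel_lt_three v M₁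
  have h₂ := listLabel_lt_three v M₂
  have h₃ := listLabel_lt_three v M₃
  have h₀' := listLabel_lt_three v' M₀
  have h₁' := listLabel_lt_three v' M₁
  have h₂' := listLabel_lt_three v' M₂
  have h₃' := listLabel_lt_three v' M₃
  have key : ∀ a b c d : ℕ, a < 3 → b < 3 → c < 3 → d < 3 →
      (a + (3 * b + (9 * c + 27 * d))) / 27 = d ∧
      (a + (3 * b + (9 * c + 27 * d))) % 27 / 9 = c ∧
      (a + (3 * b + (9 * c + 27 * d))) % 27 % 9 / 3 = b ∧
      (a + (3 * b + (9 * c + 27 * d))) % 27 % 9 % 3 / 1 = a := by omega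
  obtain ⟨k₁, k₂, k₃, k₄⟩ := key _ _ _ _ h₀ h₁ h₂ h₃
  obtain ⟨l₁, l₂, l₃, l₄⟩ := key _ _ _ _ h₀' h₁' h₂' h₃'
  simp only [digitKernel, labelCode, Nat.reducePow, Nat.reduceAdd, one_mul, add_zero, k₁, k₂, k₃,
    k₄, l₁, l₂, l₃, l₄, mul_one]
  ring

theorem members_nodup (l : List ℕ) (j : ℕ) : (members l j).Nodup :=
  List.nodup_range.filter _

theorem mem_members {l : List ℕ} {j i : ℕ} :
    i ∈ members l j ↔ i < l.length ∧ Nat.testBit (l.getD i 0) j := by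
  simp [members]

theorem wordValue_eq {l : List ℕ} (hl : ∀ j, j < 4 → (members l j).length = 4) :
    wordValue l = ∑ ρ : Perm (Fin l.length), ∑ π : Perm (Fin l.length), ∏ j ∈ range 4,
      agree (listLabel (extend ρ) (members l j)) (listLabel (extend π) (members l j)) := by
  rw [wordValue, force_eq, force_eq, forceList_eq fun a k => forceList_eq force_eq a k, force_eq]
  set Ms := [members l 0, members l 1, members l 2, members l 3] with hMs
  set β := Nat.log2 (Nat.factorial l.length) + 1 with hβ
  have hcard : #(univ : Finset (Perm (Fin l.length))) < 2 ^ β := by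
    rw [card_univ, Fintype.card_perm, Fintype.card_fin, hβ]
    exact Nat.lt_log2_self
  have hform : ∀ P : List ℕ → Prop, (∀ j < 4, P (members l j)) → ∀ M ∈ Ms, P M := by
    intro P hP M hM
    simp only [hMs, List.mem_cons, List.not_mem_nil, or_false] at hM
    rcases hM with rfl | rfl | rfl | rfl <;> exact hP _ (by decide)
  have hlen := hform (fun M => M.length = 4) hl
  have hn := hform List.Nodup fun j _ => members_nodup l j
  have hb := hform (fun M => ∀ k ∈ M, k < l.length) fun j _ k hk => (mem_members.1 hk).1
  have hcode : ∀ v : ℕ → ℕ, labelCode v 0 Ms < 3 ^ 4 := fun v => by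
    have h₀ := listLabel_lt_three v (members l 0)
    have h₁ := listLabel_lt_three v (members l 1)
    have h₂ := listLabel_lt_three v (members l 2)
    have h₃ := listLabel_lt_three v (members l 3)
    simp only [hMs, labelCode, Nat.reducePow, Nat.reduceAdd]
    omega
  have hsum := orderSum_digitRules (β := β) hlen hn hb
  simp only [pow_mul] at hsum
  have hlt : orderSum (digitRules β 0 Ms) l.length (range l.length) < 2 ^ (81 * β) := by
    rw [hsum, mul_comm, pow_mul]
    exact sum_pow_lt hcard fun π _ => hcode _
  rw [fastOrderSum_eq (digitRules_valid hn hb 0) hlt, hsum,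
    digitForm_sum 4 hcard fun π _ => hcode _]
  refine sum_congr rfl fun ρ _ => sum_congr rfl fun π _ => ?_
  rw [hMs, digitKernel_labelCode]
  simp [prod_range_succ]

/-- The label of the pairing determined by four values. -/
def pairLabel (v : Fin 4 → ℕ) : ℕ := label (v 0) (v 1) (v 2) (v 3)

theorem pairLabel_congr {v v' : Fin 4 → ℕ} (h : ∀ a b, v a < v b ↔ v' a < v' b) :
    pairLabel v = pairLabel v' := by
  have hsep : ∀ a b c d, Separated (v a) (v b) (v c) (v d) ↔
      Separated (v' a) (v' b) (v' c) (v' d) := fun a b c d => by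
    simp only [Separated, h]
  exact if_congr (hsep _ _ _ _) rfl (if_congr (hsep _ _ _ _) rfl rfl)

theorem pairLabel_lt_three (v : Fin 4 → ℕ) : pairLabel v < 3 := by
  unfold pairLabel label
  split_ifs <;> decide

theorem exists_pattern {v : Fin 4 → ℕ} (hv : Function.Injective v) :
    ∃ σ : Perm (Fin 4), ∀ a b, σ a < σ b ↔ v a < v b := by
  have hmono : StrictMono (v ∘ Tuple.sort v) :=
    (Tuple.monotone_sort v).strictMono_of_injective (hv.comp (Tuple.sort v).injective)
  refine ⟨(Tuple.sort v)⁻¹, fun a b => ?_⟩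
  have := hmono.lt_iff_lt (a := (Tuple.sort v)⁻¹ a) (b := (Tuple.sort v)⁻¹ b)
  simpa using this.symm

/-- The points of `I` with the two smallest values. -/
def lower {α : Type*} [DecidableEq α] {n : ℕ} (v : α → Fin n) (I : Finset α) : Finset α :=
  {i ∈ I | #{k ∈ I | v k < v i} < 2}

/-- The kernel comparing the pairings of `I` determined by `u` and by `v`. -/
def sim {α : Type*} [DecidableEq α] {m n : ℕ} (u : α → Fin m) (v : α → Fin n) (I : Finset α) : ℤ :=
  if lower v I = lower u I ∨ lower v I = I \ lower u I then 2 else -1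

theorem lower_map {α β : Type*} [DecidableEq α] [DecidableEq β] {m n : ℕ} (f : α ↪ β)
    {u : β → Fin m} {v : α → Fin n} {I : Finset α}
    (h : ∀ a ∈ I, ∀ b ∈ I, u (f a) < u (f b) ↔ v a < v b) :
    lower u (I.map f) = (lower v I).map f := by
  unfold lower
  rw [filter_map]
  congr 1
  refine filter_congr fun i hi => ?_
  have : filter ((fun k => u k < u (f i)) ∘ f) I = filter (fun k => v k < v i) I :=
    filter_congr fun k hk => h k hk i hi
  simp only [Function.comp_apply]
  rw [filter_map, card_map, this]

theorem sim_map {α β : Type*} [DecidableEq α] [DecidableEq β] {m n m' n' : ℕ} (f : α ↪ β)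
    {u : β → Fin m} {u' : α → Fin m'} {v : β → Fin n} {v' : α → Fin n'} {I : Finset α}
    (hu : ∀ a ∈ I, ∀ b ∈ I, u (f a) < u (f b) ↔ u' a < u' b)
    (hv : ∀ a ∈ I, ∀ b ∈ I, v (f a) < v (f b) ↔ v' a < v' b) :
    sim u v (I.map f) = sim u' v' I := by
  unfold sim
  rw [lower_map f hu, lower_map f hv, ← Finset.map_sdiff]
  exact if_congr (or_congr map_inj map_inj) rfl rfl

theorem sim_perm_four (σ τ : Perm (Fin 4)) :
    sim σ τ univ = agree (pairLabel fun a => σ a) (pairLabel fun a => τ a) := by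
  revert σ τ
  decide +kernel

theorem sim_eq_agree {n : ℕ} (f : Fin 4 ↪ Fin n) (ρ π : Perm (Fin n)) :
    sim ρ π (univ.map f)
      = agree (pairLabel fun a => ρ (f a)) (pairLabel fun a => π (f a)) := by
  have hinj : ∀ ρ : Perm (Fin n), Function.Injective fun a => ((ρ (f a) : Fin n) : ℕ) :=
    fun ρ => Fin.val_injective.comp (ρ.injective.comp f.injective)
  obtain ⟨σ, hσ⟩ := exists_pattern (hinj ρ)
  obtain ⟨τ, hτ⟩ := exists_pattern (hinj π)
  rw [sim_map f (fun a _ b _ => (hσ a b).symm) (fun a _ b _ => (hτ a b).symm), sim_perm_four,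
    pairLabel_congr hσ, pairLabel_congr hτ]

/-- The sum over all pairs of permutations of the product of the kernels of four sets. -/
def pairSum {n : ℕ} (I : Fin 4 → Finset (Fin n)) : ℤ :=
  ∑ ρ : Perm (Fin n), ∑ π : Perm (Fin n), ∏ j, sim ρ π (I j)

theorem sim_comp {n : ℕ} (ρ π σ : Perm (Fin n)) (I : Finset (Fin n)) :
    sim ρ π (I.map σ.toEmbedding) = sim (ρ * σ) (π * σ) I :=
  sim_map _ (fun _ _ _ _ => Iff.rfl) fun _ _ _ _ => Iff.rfl

theorem pairSum_map {n : ℕ} (σ : Perm (Fin n)) (I : Fin 4 → Finset (Fin n)) :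
    pairSum (fun j => (I j).map σ.toEmbedding) = pairSum I := by
  unfold pairSum
  simp only [sim_comp]
  rw [← Equiv.sum_comp (Equiv.mulRight σ) fun ρ : Perm (Fin n) =>
    ∑ π : Perm (Fin n), ∏ j, sim ρ π (I j)]
  refine sum_congr rfl fun ρ _ => ?_
  exact Equiv.sum_comp (Equiv.mulRight σ) fun π : Perm (Fin n) =>
    ∏ j, sim (ρ * σ) π (I j)

theorem pairSum_comp {n : ℕ} (g : Perm (Fin 4)) (I : Fin 4 → Finset (Fin n)) :
    pairSum (I ∘ g) = pairSum I := by
  unfold pairSum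
  refine sum_congr rfl fun ρ _ => sum_congr rfl fun π _ => ?_
  exact Equiv.prod_comp g fun j => sim ρ π (I j)

theorem sim_mul_of_fixed {n : ℕ} (ρ π τ : Perm (Fin n)) {I : Finset (Fin n)}
    (h : ∀ i ∈ I, τ i = i) : sim ρ (π * τ) I = sim ρ π I := by
  have : lower (π * τ) I = lower π I := by
    unfold lower
    refine filter_congr fun i hi => ?_
    have : filter (fun k => (π * τ) k < (π * τ) i) I = filter (fun k => π k < π i) I :=
      filter_congr fun k hk => by rw [Perm.mul_apply, Perm.mul_apply, h k hk, h i hi]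
    rw [this]
  unfold sim
  rw [this]

/-- The cyclic permutation of the first three of four elements. -/
def threeCycle : Perm (Fin 4) := swap 0 1 * swap 1 2

theorem sum_agree_threeCycle (σ : Perm (Fin 4)) {p : ℕ} (hp : p < 3) :
    ∑ m : Fin 3, agree p (pairLabel fun a => σ ((threeCycle ^ (m : ℕ)) a)) = 0 := by
  have : ∀ (σ : Perm (Fin 4)) (p : Fin 3),
      ∑ m : Fin 3, agree p (pairLabel fun a => σ ((threeCycle ^ (m : ℕ)) a)) = 0 := by
    decide +kernel
  exact this σ ⟨p, hp⟩

theorem pairSum_eq_zero {n : ℕ} {I : Fin 4 → Finset (Fin n)} {j : Fin 4} (hcard : #(I j) = 4)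
    (hpriv : 3 ≤ #{i ∈ I j | ∀ k, k ≠ j → i ∉ I k}) : pairSum I = 0 := by
  obtain ⟨P, hP, hPcard⟩ := exists_subset_card_eq hpriv
  have hPI : P ⊆ I j := hP.trans (filter_subset _ _)
  have hrest : #(I j \ P) = 1 := by rw [card_sdiff_of_subset hPI]; omega
  obtain ⟨t, ht⟩ := card_eq_one.1 hrest
  obtain ⟨x, y, z, hxy, hxz, hyz, rfl⟩ := card_eq_three.1 hPcard
  have htI : t ∈ I j \ {x, y, z} := by rw [ht]; simp
  simp only [mem_sdiff, mem_insert, mem_singleton, not_or] at htI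
  obtain ⟨-, htx, hty, htz⟩ := htI
  let f : Fin 4 ↪ Fin n := ⟨![x, y, z, t], by
    intro a b hab
    fin_cases a <;> fin_cases b <;> simp_all⟩
  have hf : I j = univ.map f := by
    rw [← sdiff_union_of_subset hPI, ht]
    ext i
    simp only [mem_union, mem_singleton, mem_insert, mem_map, mem_univ, true_and, f,
      Fin.exists_fin_succ]
    simp
    tauto
  let τ : Perm (Fin n) := threeCycle.viaFintypeEmbedding f
  have hτ : ∀ (m : ℕ) (a : Fin 4), (τ ^ m) (f a) = f ((threeCycle ^ m) a) := by
    intro m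
    induction m with
    | zero => intro a; rfl
    | succ m ih =>
      intro a
      rw [pow_succ, pow_succ, Perm.mul_apply, Perm.mul_apply,
        show τ (f a) = f (threeCycle a) from Perm.viaFintypeEmbedding_apply_image _ _ _, ih]
  have hτfix : ∀ k, k ≠ j → ∀ i ∈ I k, τ i = i := by
    intro k hk i hi
    by_cases hif : i ∈ Set.range f
    · obtain ⟨a, rfl⟩ := hif
      have hpriv' : ∀ i' ∈ ({x, y, z} : Finset (Fin n)), i' ∉ I k := fun i' hi' =>
        (mem_filter.1 (hP hi')).2 k hk
      have ha : a = 3 := by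
        by_contra ha
        refine hpriv' (f a) ?_ hi
        fin_cases a
        · exact mem_insert_self _ _
        · exact mem_insert_of_mem (mem_insert_self _ _)
        · exact mem_insert_of_mem (mem_insert_of_mem (mem_singleton_self _))
        · exact absurd rfl ha
      subst ha
      exact Perm.viaFintypeEmbedding_apply_image threeCycle f 3
    · exact Perm.viaFintypeEmbedding_apply_notMem_range _ _ hif
  have hτfix' : ∀ m : ℕ, ∀ k, k ≠ j → ∀ i ∈ I k, (τ ^ m) i = i := fun m k hk i hi => by
    induction m with
    | zero => rfl
    | succ m ih => rw [pow_succ, Perm.mul_apply, hτfix k hk i hi, ih]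
  have hshift : ∀ m : Fin 3, pairSum I
      = ∑ ρ : Perm (Fin n), ∑ π : Perm (Fin n), ∏ k, sim ρ (π * τ ^ (m : ℕ)) (I k) := fun m =>
    sum_congr rfl fun ρ _ => (Equiv.sum_comp (Equiv.mulRight (τ ^ (m : ℕ)))
      fun π : Perm (Fin n) => ∏ k, sim ρ π (I k)).symm
  have hthree : 3 * pairSum I = 0 := by
    calc 3 * pairSum I = ∑ m : Fin 3, pairSum I := by simp
      _ = ∑ m : Fin 3, ∑ ρ : Perm (Fin n), ∑ π : Perm (Fin n),
          ∏ k, sim ρ (π * τ ^ (m : ℕ)) (I k) := sum_congr rfl fun m _ => hshift m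
      _ = ∑ ρ : Perm (Fin n), ∑ π : Perm (Fin n), ∑ m : Fin 3,
          ∏ k, sim ρ (π * τ ^ (m : ℕ)) (I k) := by
        rw [sum_comm]
        exact sum_congr rfl fun ρ _ => sum_comm
      _ = 0 := by
        refine sum_eq_zero fun ρ _ => sum_eq_zero fun π _ => ?_
        have hprod : ∀ m : Fin 3, ∏ k, sim ρ (π * τ ^ (m : ℕ)) (I k)
            = sim ρ (π * τ ^ (m : ℕ)) (I j) * ∏ k ∈ univ.erase j, sim ρ π (I k) := fun m => by
          rw [← mul_prod_erase univ _ (mem_univ j)]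
          congr 1
          exact prod_congr rfl fun k hk =>
            sim_mul_of_fixed _ _ _ (hτfix' m k (ne_of_mem_erase hk))
        rw [sum_congr rfl fun m _ => hprod m, ← sum_mul]
        obtain ⟨σ, hσ⟩ := exists_pattern (v := fun a => ((π (f a) : Fin n) : ℕ))
          (Fin.val_injective.comp (π.injective.comp f.injective))
        have : ∀ m : Fin 3, sim ρ (π * τ ^ (m : ℕ)) (I j)
            = agree (pairLabel fun a => ρ (f a))
              (pairLabel fun a => σ ((threeCycle ^ (m : ℕ)) a)) := fun m => by
          rw [hf, sim_eq_agree]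
          congr 1
          refine pairLabel_congr fun a b => ?_
          rw [Perm.mul_apply, Perm.mul_apply, hτ, hτ]
          exact (hσ _ _).symm
        rw [sum_congr rfl fun m _ => this m, sum_agree_threeCycle σ (pairLabel_lt_three _),
          zero_mul]
  omega

/-- The indicator that `σ` maps `a` and `b` below `c` and `d`. -/
def below (σ : Perm (Fin 4)) (a b c d : Fin 4) : ℤ :=
  if (σ a < σ c ∧ σ a < σ d) ∧ σ b < σ c ∧ σ b < σ d then 1 else 0

/-- The integer form of the kernel `B_4`. -/
def quadKernel (σ ω : Perm (Fin 4)) : ℤ :=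
  below σ (ω 0) (ω 2) (ω 1) (ω 3) + below σ (ω 1) (ω 3) (ω 0) (ω 2)
    - below σ (ω 0) (ω 3) (ω 1) (ω 2) - below σ (ω 1) (ω 2) (ω 0) (ω 3)

theorem sum_quadKernel (σ : Perm (Fin 4)) :
    ∑ ω : Perm (Fin 4), quadKernel 1 ω * quadKernel σ ω
      = 8 * agree (pairLabel fun a => a) (pairLabel fun a => σ a) := by
  revert σ
  decide +kernel

theorem below_eq {u : Fin 4 → ℝ} {σ : Perm (Fin 4)} (hu : ∀ a, u a = ((σ a).val : ℝ) + 1)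
    (a b c d : Fin 4) :
    (if max (u a) (u b) < min (u c) (u d) then (1 : ℝ) else 0) = below σ a b c d := by
  have hlt : ∀ a b, u a < u b ↔ σ a < σ b := fun a b => by
    rw [hu, hu, add_lt_add_iff_right, Nat.cast_lt, Fin.lt_def]
  rw [below, Int.cast_ite, Int.cast_one, Int.cast_zero]
  refine if_congr ?_ rfl rfl
  rw [max_lt_iff, lt_min_iff, lt_min_iff, hlt, hlt, hlt, hlt]

theorem sum_kernel_eq_sum_sim
    (B : (Fin 4 → ℝ) → Perm (Fin 4) → ℝ)
    (hB : ∀ u ω, B u ω =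
        (if max (u (ω 0)) (u (ω 2)) < min (u (ω 1)) (u (ω 3)) then (1 : ℝ) else 0)
      + (if max (u (ω 1)) (u (ω 3)) < min (u (ω 0)) (u (ω 2)) then (1 : ℝ) else 0)
      - (if max (u (ω 0)) (u (ω 3)) < min (u (ω 1)) (u (ω 2)) then (1 : ℝ) else 0)
      - (if max (u (ω 1)) (u (ω 2)) < min (u (ω 0)) (u (ω 3)) then (1 : ℝ) else 0))
    (vec : Perm (Fin 4) → Fin 4 → ℝ)
    (hvec : ∀ σ i, vec σ i = ((σ i).val : ℝ) + 1)
    (e : Fin 4 → ℝ) (he : ∀ i, e i = ((i : ℕ) : ℝ) + 1)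
    (ψ : Perm (Fin 4) → ℝ)
    (hψ : ∀ σ, ψ σ = (1 / 24) * ∑ ω : Perm (Fin 4), B e ω * B (vec σ) ω)
    {n : ℕ} (pat : Perm (Fin n) → Finset (Fin n) → Perm (Fin 4))
    (hpat : ∀ (π : Perm (Fin n)) (I : Finset (Fin n)) (h : #I = 4) (a b : Fin 4),
        pat π I a < pat π I b ↔
          π ((I.orderIsoOfFin h a : Fin n)) < π ((I.orderIsoOfFin h b : Fin n)))
    (π : Perm (Fin n)) :
    3 * ∑ I ∈ univ.filter (fun I : Finset (Fin n) => #I = 4), ψ (pat π I)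
      = ((∑ I ∈ univ.filter (fun I : Finset (Fin n) => #I = 4), sim (1 : Perm (Fin n)) π I : ℤ)
        : ℝ) := by
  have hquad : ∀ (u : Fin 4 → ℝ) (σ ω : Perm (Fin 4)), (∀ a, u a = ((σ a).val : ℝ) + 1) →
      B u ω = quadKernel σ ω := fun u σ ω hu => by
    rw [hB, below_eq hu, below_eq hu, below_eq hu, below_eq hu]
    simp only [quadKernel, Int.cast_add, Int.cast_sub]
  have hψ' : ∀ σ, 3 * ψ σ
      = (agree (pairLabel fun a => a) (pairLabel fun a => σ a) : ℤ) := fun σ => by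
    have : ∑ ω : Perm (Fin 4), B e ω * B (vec σ) ω
        = ((∑ ω : Perm (Fin 4), quadKernel 1 ω * quadKernel σ ω : ℤ) : ℝ) := by
      push_cast
      exact sum_congr rfl fun ω _ => by rw [hquad e 1 ω he, hquad _ σ ω (hvec σ)]
    rw [hψ, this, sum_quadKernel]
    push_cast
    ring
  rw [mul_sum, Int.cast_sum]
  refine sum_congr rfl fun I hI => ?_
  have hI4 : #I = 4 := (mem_filter.1 hI).2
  let f : Fin 4 ↪ Fin n := (I.orderEmbOfFin hI4).toEmbedding
  have hIf : I = univ.map f := by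
    rw [← coe_inj, coe_map, coe_univ, Set.image_univ]
    exact (range_orderEmbOfFin I hI4).symm
  have hsim := sim_eq_agree f 1 π
  rw [← hIf] at hsim
  rw [hψ', hsim]
  congr 2
  · refine pairLabel_congr fun a b => ?_
    exact ((I.orderEmbOfFin hI4).lt_iff_lt (a := a) (b := b)).symm
  · exact pairLabel_congr fun a b => hpat π I hI4 a b

theorem factorial_mul_sum_pow_four (n : ℕ) :
    (n.factorial : ℤ) * ∑ π : Perm (Fin n),
        (∑ I ∈ univ.filter (fun I : Finset (Fin n) => #I = 4), sim (1 : Perm (Fin n)) π I) ^ 4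
      = ∑ I ∈ univ.filter (fun I : Fin 4 → Finset (Fin n) => ∀ j, #(I j) = 4), pairSum I := by
  have hinv : ∀ ρ : Perm (Fin n), ∑ π : Perm (Fin n),
      (∑ I ∈ univ.filter (fun I : Finset (Fin n) => #I = 4), sim (1 : Perm (Fin n)) π I) ^ 4
      = ∑ π : Perm (Fin n),
      (∑ I ∈ univ.filter (fun I : Finset (Fin n) => #I = 4), sim ρ π I) ^ 4 := fun ρ => by
    rw [← Equiv.sum_comp (Equiv.mulRight ρ) fun π : Perm (Fin n) =>
      (∑ I ∈ univ.filter (fun I : Finset (Fin n) => #I = 4), sim ρ π I) ^ 4]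
    refine sum_congr rfl fun π _ => congrArg (· ^ 4) ?_
    refine sum_equiv ρ.symm.finsetCongr (fun I => ?_) fun I _ => ?_
    · simp
    · rw [Equiv.finsetCongr_apply]
      show _ = sim ρ (π * ρ) _
      have := sim_comp ρ (π * ρ) ρ⁻¹ I
      rw [mul_inv_cancel, mul_inv_cancel_right] at this
      exact this.symm
  have hset : univ.filter (fun I : Fin 4 → Finset (Fin n) => ∀ j, #(I j) = 4)
      = Fintype.piFinset fun _ : Fin 4 => univ.filter (fun I : Finset (Fin n) => #I = 4) := by
    ext I
    simp
  have hpow : ∀ ρ π : Perm (Fin n),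
      (∑ I ∈ univ.filter (fun I : Finset (Fin n) => #I = 4), sim ρ π I) ^ 4
      = ∑ I ∈ univ.filter (fun I : Fin 4 → Finset (Fin n) => ∀ j, #(I j) = 4),
        ∏ j, sim ρ π (I j) := fun ρ π => by
    rw [hset, ← prod_univ_sum]
    simp
  calc _ = ∑ ρ : Perm (Fin n), ∑ π : Perm (Fin n),
        (∑ I ∈ univ.filter (fun I : Finset (Fin n) => #I = 4), sim ρ π I) ^ 4 := by
        rw [← sum_congr rfl fun ρ _ => hinv ρ, sum_const, card_univ, Fintype.card_perm,
          Fintype.card_fin, nsmul_eq_mul]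
    _ = ∑ ρ : Perm (Fin n), ∑ I ∈ univ.filter (fun I : Fin 4 → Finset (Fin n) => ∀ j, #(I j) = 4),
        ∑ π : Perm (Fin n), ∏ j, sim ρ π (I j) :=
        sum_congr rfl fun ρ _ => by rw [sum_congr rfl fun π _ => hpow ρ π, sum_comm]
    _ = _ := by rw [sum_comm]; rfl

/-- The rank pattern of a permutation along an embedding. -/
def pattern {b n : ℕ} (f : Fin b ↪ Fin n) (ρ : Perm (Fin n)) : Perm (Fin b) :=
  (Tuple.sort (ρ ∘ f))⁻¹

theorem pattern_lt_pattern {b n : ℕ} (f : Fin b ↪ Fin n) (ρ : Perm (Fin n)) (i k : Fin b) :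
    pattern f ρ i < pattern f ρ k ↔ ρ (f i) < ρ (f k) := by
  have hmono : StrictMono ((ρ ∘ f) ∘ Tuple.sort (ρ ∘ f)) :=
    (Tuple.monotone_sort _).strictMono_of_injective
      ((ρ.injective.comp f.injective).comp (Equiv.injective _))
  have := hmono.lt_iff_lt (a := pattern f ρ i) (b := pattern f ρ k)
  simpa [pattern] using this.symm

theorem perm_eq_of_lt_iff_lt {b : ℕ} {σ τ : Perm (Fin b)} (h : ∀ i k, σ i < σ k ↔ τ i < τ k) :
    σ = τ := by
  have hmono : StrictMono (τ * σ⁻¹) := fun i k hik => by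
    have := h (σ⁻¹ i) (σ⁻¹ k)
    simpa [hik] using this
  have hid : ⇑(τ * σ⁻¹) = id := by
    refine (hmono.range_inj strictMono_id).1 ?_
    rw [Set.range_id, (τ * σ⁻¹).surjective.range_eq]
  ext i
  have : τ (σ⁻¹ (σ i)) = σ i := congrFun hid (σ i)
  rw [← this, show σ⁻¹ (σ i) = i from σ.symm_apply_apply i]

theorem pattern_mul_viaFintypeEmbedding {b n : ℕ} (f : Fin b ↪ Fin n) (ρ : Perm (Fin n))
    (σ : Perm (Fin b)) : pattern f (ρ * σ.viaFintypeEmbedding f) = pattern f ρ * σ :=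
  perm_eq_of_lt_iff_lt fun i k => by
    rw [pattern_lt_pattern, Perm.mul_apply, Perm.mul_apply, Perm.mul_apply, Perm.mul_apply,
      Perm.viaFintypeEmbedding_apply_image, Perm.viaFintypeEmbedding_apply_image,
      pattern_lt_pattern]

theorem factorial_mul_sum_pattern {b n : ℕ} (f : Fin b ↪ Fin n) (F : Perm (Fin b) → ℤ) :
    (b.factorial : ℤ) * ∑ ρ : Perm (Fin n), F (pattern f ρ)
      = n.factorial * ∑ τ : Perm (Fin b), F τ := by
  have hshift : ∀ σ : Perm (Fin b),
      ∑ ρ : Perm (Fin n), F (pattern f ρ) = ∑ ρ : Perm (Fin n), F (pattern f ρ * σ) := fun σ => by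
    rw [← Equiv.sum_comp (Equiv.mulRight (σ.viaFintypeEmbedding f)) fun ρ => F (pattern f ρ)]
    exact sum_congr rfl fun ρ _ => congrArg F (pattern_mul_viaFintypeEmbedding f ρ σ)
  calc (b.factorial : ℤ) * ∑ ρ : Perm (Fin n), F (pattern f ρ)
      = ∑ σ : Perm (Fin b), ∑ ρ : Perm (Fin n), F (pattern f ρ * σ) := by
        rw [← sum_congr rfl fun σ _ => hshift σ, sum_const, card_univ, Fintype.card_perm,
          Fintype.card_fin, nsmul_eq_mul]
    _ = ∑ ρ : Perm (Fin n), ∑ τ : Perm (Fin b), F τ := by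
        rw [sum_comm]
        exact sum_congr rfl fun ρ _ => Equiv.sum_comp (Equiv.mulLeft (pattern f ρ)) F
    _ = n.factorial * ∑ τ : Perm (Fin b), F τ := by
        rw [sum_const, card_univ, Fintype.card_perm, Fintype.card_fin, nsmul_eq_mul]

theorem pairSum_map_embedding {b n : ℕ} (f : Fin b ↪ Fin n) (J : Fin 4 → Finset (Fin b)) :
    (b.factorial : ℤ) ^ 2 * pairSum (fun j => (J j).map f) = (n.factorial : ℤ) ^ 2 * pairSum J := by
  have hsim : ∀ (ρ π : Perm (Fin n)) (j : Fin 4),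
      sim ρ π ((J j).map f) = sim (pattern f ρ) (pattern f π) (J j) := fun ρ π j =>
    sim_map f (fun i _ k _ => (pattern_lt_pattern f ρ i k).symm)
      fun i _ k _ => (pattern_lt_pattern f π i k).symm
  unfold pairSum
  simp only [hsim]
  rw [sq, sq, mul_assoc, mul_assoc, mul_sum (s := univ) (a := (b.factorial : ℤ)),
    sum_congr rfl fun ρ _ => factorial_mul_sum_pattern f
      fun τ => ∏ j, sim (pattern f ρ) τ (J j), ← mul_sum, mul_left_comm,
    factorial_mul_sum_pattern f fun σ => ∑ τ : Perm (Fin b), ∏ j, sim σ τ (J j)]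

/-- The sets of positions of a word over `{0, …, 15}` whose letter has a given binary digit. -/
def wordSets {n : ℕ} (w : Fin n → Fin 16) (j : Fin 4) : Finset (Fin n) :=
  {i | (w i : ℕ).testBit j}

theorem mem_wordSets {n : ℕ} {w : Fin n → Fin 16} {j : Fin 4} {i : Fin n} :
    i ∈ wordSets w j ↔ (w i : ℕ).testBit j := by
  simp [wordSets]

/-- The word of length `n` obtained from a list by truncating or by appending zeros. -/
def toWord (l : List ℕ) (n : ℕ) (i : Fin n) : Fin 16 := Fin.ofNat 16 (l.getD i 0)

/-- The sum of the products of the four kernels over all pairs of permutations of the positions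
of a word. -/
def wordSum (l : List ℕ) : ℤ := pairSum (wordSets (toWord l l.length))

theorem pairSum_toWord {l : List ℕ} {n : ℕ} (hn : l.length ≤ n) :
    (l.length.factorial : ℤ) ^ 2 * pairSum (wordSets (toWord l n))
      = (n.factorial : ℤ) ^ 2 * wordSum l := by
  rw [wordSum, ← pairSum_map_embedding (Fin.castLEEmb hn)]
  congr 2
  ext j i
  simp only [mem_wordSets, mem_map, Fin.castLEEmb_apply]
  constructor
  · intro h
    have hi : (i : ℕ) < l.length := by
      by_contra hi
      rw [toWord, List.getD_eq_default _ _ (not_lt.1 hi)] at h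
      simp at h
    exact ⟨⟨i, hi⟩, h, rfl⟩
  · rintro ⟨k, hk, rfl⟩
    exact hk

theorem wordSum_eq_wordValue {l : List ℕ} (hlt : ∀ S ∈ l, S < 16)
    (hl : ∀ j, j < 4 → (members l j).length = 4) : wordSum l = wordValue l := by
  rw [wordValue_eq hl, wordSum, pairSum]
  refine sum_congr rfl fun ρ _ => sum_congr rfl fun π _ => ?_
  rw [← Fin.prod_univ_eq_prod_range fun j =>
    agree (listLabel (extend ρ) (members l j)) (listLabel (extend π) (members l j))]
  refine prod_congr rfl fun j _ => ?_
  obtain ⟨p, q, r, s, hM⟩ : ∃ p q r s, members l j = [p, q, r, s] := by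
    have := hl j j.2
    match h : members l j, this with
    | [p, q, r, s], _ => exact ⟨p, q, r, s, rfl⟩
  have hnodup := members_nodup l j
  have hmem : ∀ i, i ∈ [p, q, r, s] ↔ i < l.length ∧ Nat.testBit (l.getD i 0) j := fun i => by
    rw [← hM, mem_members]
  rw [hM] at hnodup ⊢
  have hlt' : ∀ i ∈ [p, q, r, s], i < l.length := fun i hi => ((hmem i).1 hi).1
  let f : Fin 4 ↪ Fin l.length := ⟨fun a => ⟨[p, q, r, s].get a, hlt' _ (List.get_mem _ _)⟩,
    fun a b hab => hnodup.injective_get (Fin.mk.inj hab)⟩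
  have hf : wordSets (toWord l l.length) j = univ.map f := by
    ext i
    have hS : l.getD i 0 < 16 := by
      rw [List.getD_eq_getElem _ _ i.2]
      exact hlt _ (List.getElem_mem _)
    rw [mem_wordSets, mem_map, toWord, Fin.val_ofNat, Nat.mod_eq_of_lt hS]
    constructor
    · intro h
      obtain ⟨a, ha⟩ := List.get_of_mem ((hmem i).2 ⟨i.2, h⟩)
      exact ⟨a, mem_univ a, Fin.ext ha⟩
    · rintro ⟨a, -, rfl⟩
      exact ((hmem _).1 (List.get_mem _ _)).2
  rw [hf, sim_eq_agree]
  have hlabel : ∀ ρ : Perm (Fin l.length),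
      (pairLabel fun a => (ρ (f a) : ℕ)) = listLabel (extend ρ) [p, q, r, s] := fun ρ => by
    simp only [← extend_val]
    rfl
  rw [hlabel, hlabel]

theorem wordSets_bijective (n : ℕ) :
    Function.Bijective (wordSets : (Fin n → Fin 16) → Fin 4 → Finset (Fin n)) := by
  refine (Fintype.bijective_iff_injective_and_card _).2 ⟨fun w w' h => funext fun i => ?_, ?_⟩
  · have hdigits : ∀ S S' : Fin 16,
        (∀ j : Fin 4, (S : ℕ).testBit j = (S' : ℕ).testBit j) → S = S' := by
      decide +kernel
    refine hdigits _ _ fun j => Bool.eq_iff_iff.2 ?_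
    rw [← mem_wordSets, ← mem_wordSets, h]
  · simp only [Fintype.card_fun, Fintype.card_fin, Fintype.card_finset]
    rw [← pow_mul, mul_comm, pow_mul]
    norm_num

theorem pairSum_wordSets_comp {n : ℕ} (w : Fin n → Fin 16) (σ : Perm (Fin n)) :
    pairSum (wordSets (w ∘ σ)) = pairSum (wordSets w) := by
  rw [← pairSum_map σ (wordSets (w ∘ σ))]
  congr 1
  ext j i
  simp only [mem_map_equiv, mem_wordSets, Function.comp_apply, Equiv.apply_symm_apply]

theorem exists_perm_comp_eq {α κ : Type*} [Fintype α] [DecidableEq κ] {w w' : α → κ}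
    (h : ∀ S, #{i | w i = S} = #{i | w' i = S}) : ∃ σ : Perm α, w' = w ∘ σ := by
  have hcard : ∀ S, Fintype.card {i // w' i = S} = Fintype.card {i // w i = S} := fun S => by
    rw [Fintype.card_subtype, Fintype.card_subtype, h]
  let E : ∀ S, {i // w' i = S} ≃ {i // w i = S} := fun S => Fintype.equivOfCardEq (hcard S)
  refine ⟨(Equiv.sigmaFiberEquiv w').symm.trans
    ((Equiv.sigmaCongrRight E).trans (Equiv.sigmaFiberEquiv w)), funext fun i => ?_⟩
  exact (E (w' i) ⟨i, rfl⟩).2.symm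

theorem card_filter_comp_perm {α κ : Type*} [Fintype α] [DecidableEq κ] (w : α → κ)
    (σ : Perm α) (S : κ) : #{i | (w ∘ σ) i = S} = #{i | w i = S} := by
  refine card_equiv σ fun i => ?_
  simp

theorem card_same_content {α κ : Type*} [Fintype α] [DecidableEq α] [Fintype κ] [DecidableEq κ]
    (w : α → κ) :
    #{w' : α → κ | ∀ S, #{i | w' i = S} = #{i | w i = S}} * ∏ S, (#{i | w i = S}).factorial
      = (Fintype.card α).factorial := by
  have hfiber : ∀ w' ∈ ({w' : α → κ | ∀ S, #{i | w' i = S} = #{i | w i = S}} : Finset (α → κ)),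
      #{σ : Perm α | w ∘ ⇑σ = w'} = ∏ S, (#{i | w i = S}).factorial := by
    intro w' hw'
    obtain ⟨τ, rfl⟩ := exists_perm_comp_eq fun S => ((mem_filter.1 hw').2 S).symm
    have hstab := DomMulAct.stabilizer_card w
    rw [Fintype.card_subtype] at hstab
    simp only [Fintype.card_subtype] at hstab
    rw [← hstab]
    refine card_equiv (Equiv.mulRight τ⁻¹) fun σ => ?_
    simp only [mem_filter, mem_univ, true_and, Equiv.coe_mulRight]
    constructor
    · intro h
      funext i
      have := congrFun h (τ⁻¹ i)
      simpa using this
    · intro h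
      funext i
      have := congrFun h (τ i)
      simpa using this
  rw [← Fintype.card_perm, ← card_univ, card_eq_sum_card_fiberwise (f := fun σ : Perm α => w ∘ σ)
    (t := {w' : α → κ | ∀ S, #{i | w' i = S} = #{i | w i = S}}), sum_congr rfl hfiber, sum_const,
    smul_eq_mul]
  intro σ _
  simp only [coe_filter, mem_univ, true_and, Set.mem_ofPred_eq]
  exact card_filter_comp_perm w σ

/-- The numbers of occurrences of the letters `1, …, 15` in a word. -/
def content {n : ℕ} (w : Fin n → Fin 16) : List ℕ :=
  (List.range 15).map fun S => #{i | (w i : ℕ) = S + 1}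

/-- The list with prescribed numbers of occurrences of the letters `k, k + 1, …`. -/
def spellFrom : ℕ → List ℕ → List ℕ
  | _, [] => []
  | k, m :: c => spellFrom (k + 1) c ++ List.replicate m k

theorem length_spellFrom (k : ℕ) (c : List ℕ) : (spellFrom k c).length = c.sum := by
  induction c generalizing k with
  | nil => rfl
  | cons m c ih => simp [spellFrom, ih, add_comm]

theorem count_spellFrom (k : ℕ) (c : List ℕ) (S : ℕ) :
    (spellFrom k c).count (k + S) = c.getD S 0 ∧ ∀ T, T < k → (spellFrom k c).count T = 0 := by
  induction c generalizing k S with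
  | nil => simp [spellFrom]
  | cons m c ih =>
    refine ⟨?_, fun T hT => ?_⟩
    · cases S with
      | zero => simp [spellFrom, List.count_append, (ih (k + 1) 0).2 k (Nat.lt_succ_self k)]
      | succ S =>
        have := (ih (k + 1) S).1
        rw [show k + 1 + S = k + (S + 1) by omega] at this
        simp [spellFrom, List.count_append, List.count_replicate, this]
    · rw [spellFrom, List.count_append, (ih (k + 1) 0).2 T (by omega), List.count_replicate,
        if_neg (by simpa using Nat.ne_of_gt hT)]

/-- The list with prescribed numbers of occurrences of the letters `1, 2, …`. -/
def spell (c : List ℕ) : List ℕ := spellFrom 1 c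

theorem length_spell (c : List ℕ) : (spell c).length = c.sum := length_spellFrom 1 c

theorem count_spell_succ (c : List ℕ) (S : ℕ) : (spell c).count (S + 1) = c.getD S 0 := by
  rw [add_comm]
  exact (count_spellFrom 1 c S).1

theorem count_spell_zero (c : List ℕ) : (spell c).count 0 = 0 :=
  (count_spellFrom 1 c 0).2 0 one_pos

theorem lt_of_mem_spell {c : List ℕ} (hc : c.length = 15) {S : ℕ} (hS : S ∈ spell c) : S < 16 := by
  by_contra h
  obtain ⟨T, rfl⟩ : ∃ T, S = T + 1 := ⟨S - 1, by omega⟩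
  have := List.count_pos_iff.2 hS
  rw [count_spell_succ, List.getD_eq_default _ _ (by omega)] at this
  exact lt_irrefl _ this

theorem card_toWord {l : List ℕ} {n : ℕ} (hl : l.length ≤ n) (hlt : ∀ S ∈ l, S < 16) (S : Fin 16) :
    #{i | toWord l n i = S} = l.count (S : ℕ) + if S = 0 then n - l.length else 0 := by
  have hlist : List.ofFn (toWord l n)
      = l.map (Fin.ofNat 16) ++ List.replicate (n - l.length) 0 := by
    refine List.ext_getElem (by simp; omega) fun i h₁ h₂ => ?_
    rw [List.getElem_ofFn, List.getElem_append]
    split_ifs with hi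
    · rw [List.length_map] at hi
      rw [List.getElem_map, toWord, List.getD_eq_getElem _ _ hi]
    · rw [List.length_map, not_lt] at hi
      rw [List.getElem_replicate, toWord, List.getD_eq_default _ _ hi]
      rfl
  have hcount : #{i | toWord l n i = S} = (List.ofFn (toWord l n)).count S := by
    rw [← Multiset.coe_count, ← Fin.univ_val_map, Multiset.count_map]
    simp only [eq_comm]
    rfl
  rw [hcount, hlist, List.count_append, List.count_replicate]
  congr 1
  · rw [List.count, List.countP_map, List.count]
    refine List.countP_congr fun T hT => ?_
    simp only [Function.comp_apply, beq_iff_eq]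
    rw [Fin.ext_iff, Fin.val_ofNat, Nat.mod_eq_of_lt (hlt T hT)]
  · exact if_congr (by rw [beq_iff_eq, eq_comm]) rfl rfl

theorem length_content {n : ℕ} (w : Fin n → Fin 16) : (content w).length = 15 := by
  simp [content]

theorem getD_content {n : ℕ} (w : Fin n → Fin 16) (S : Fin 15) :
    (content w).getD S 0 = #{i | w i = S.succ} := by
  rw [List.getD_eq_getElem _ _ (by rw [length_content]; exact S.2)]
  simp [content, Fin.ext_iff]

theorem content_eq_iff {n : ℕ} {w : Fin n → Fin 16} {c : List ℕ} (hc : c.length = 15) :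
    content w = c ↔ ∀ S : Fin 15, #{i | w i = S.succ} = c.getD S 0 := by
  refine ⟨fun h S => by rw [← h, getD_content], fun h => ?_⟩
  refine List.ext_getElem (by rw [length_content, hc]) fun S h₁ h₂ => ?_
  have := h ⟨S, by omega⟩
  rw [← getD_content] at this
  rwa [List.getD_eq_getElem _ _ h₁, List.getD_eq_getElem _ _ h₂] at this

theorem sum_map_eq_sum_getD {m : ℕ} {c : List ℕ} (hc : c.length = m) (f : ℕ → ℕ) :
    (c.map f).sum = ∑ S : Fin m, f (c.getD S 0) := by
  subst hc
  rw [← List.sum_ofFn]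
  congr 1
  refine List.ext_getElem (by simp) fun S h₁ h₂ => ?_
  simp

theorem prod_map_eq_prod_getD {m : ℕ} {c : List ℕ} (hc : c.length = m) (f : ℕ → ℕ) :
    (c.map f).prod = ∏ S : Fin m, f (c.getD S 0) := by
  subst hc
  rw [← List.prod_ofFn]
  congr 1
  refine List.ext_getElem (by simp) fun S h₁ h₂ => ?_
  simp

theorem sum_content_add {n : ℕ} (w : Fin n → Fin 16) : #{i | w i = 0} + (content w).sum = n := by
  have h : ∑ S, #{i | w i = S} = n := by
    rw [← card_eq_sum_card_fiberwise (fun i _ => by simp), card_univ, Fintype.card_fin]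
  rw [Fin.sum_univ_succ] at h
  have hsum := sum_map_eq_sum_getD (length_content w) id
  rw [List.map_id] at hsum
  simp only [id_eq, getD_content] at hsum
  rw [hsum, h]

theorem card_toWord_spell {c : List ℕ} (hc : c.length = 15) {n : ℕ} (hn : c.sum ≤ n) :
    #{i | toWord (spell c) n i = 0} = n - c.sum ∧
      ∀ S : Fin 15, #{i | toWord (spell c) n i = S.succ} = c.getD S 0 := by
  have h := card_toWord (l := spell c) (n := n) (by rwa [length_spell])
    fun S hS => lt_of_mem_spell hc hS
  refine ⟨?_, fun S => ?_⟩
  · rw [h, if_pos rfl, length_spell, Fin.val_zero, count_spell_zero, zero_add]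
  · rw [h, if_neg (Fin.succ_ne_zero S), Fin.val_succ, count_spell_succ, add_zero]

theorem sum_pairSum_of_content {c : List ℕ} (hc : c.length = 15) (n : ℕ) :
    (c.sum.factorial * (c.map Nat.factorial).prod : ℤ)
        * ∑ w ∈ univ.filter (fun w : Fin n → Fin 16 => content w = c), pairSum (wordSets w)
      = n.choose c.sum * (n.factorial : ℤ) ^ 2 * wordSum (spell c) := by
  rcases lt_or_ge n c.sum with hn | hn
  · rw [Nat.choose_eq_zero_of_lt hn, filter_false_of_mem]
    · simp
    · rintro w - rfl
      have := sum_content_add w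
      omega
  obtain ⟨h0, hsucc⟩ := card_toWord_spell hc hn
  have hclass : univ.filter (fun w : Fin n → Fin 16 => content w = c)
      = univ.filter (fun w : Fin n → Fin 16 =>
        ∀ S, #{i | w i = S} = #{i | toWord (spell c) n i = S}) := by
    refine filter_congr fun w _ => ?_
    rw [Fin.forall_fin_succ, content_eq_iff hc, h0]
    simp only [hsucc]
    refine ⟨fun h => ⟨?_, h⟩, fun h => h.2⟩
    have := sum_content_add w
    rw [(content_eq_iff hc).2 h] at this
    omega
  have hvalue : ∀ w ∈ univ.filter (fun w : Fin n → Fin 16 => content w = c),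
      pairSum (wordSets w) = pairSum (wordSets (toWord (spell c) n)) := fun w hw => by
    rw [hclass] at hw
    obtain ⟨σ, hσ⟩ := exists_perm_comp_eq fun S => ((mem_filter.1 hw).2 S).symm
    rw [hσ, pairSum_wordSets_comp]
  have hcard : #(univ.filter fun w : Fin n → Fin 16 => content w = c)
      * ∏ S, (#{i | toWord (spell c) n i = S}).factorial = (Fintype.card (Fin n)).factorial := by
    rw [hclass]
    convert card_same_content (toWord (spell c) n)
  rw [Fin.prod_univ_succ, h0, Fintype.card_fin] at hcard
  simp only [hsucc] at hcard
  rw [← prod_map_eq_prod_getD hc] at hcard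
  have hpair := pairSum_toWord (l := spell c) (n := n) (by rwa [length_spell])
  rw [length_spell] at hpair
  rw [sum_congr rfl hvalue, sum_const, nsmul_eq_mul]
  have hchoose := Nat.choose_mul_factorial_mul_factorial hn
  have hne : ((c.sum.factorial * (n - c.sum).factorial : ℕ) : ℤ) ≠ 0 := by positivity
  refine mul_left_cancel₀ hne ?_
  generalize (c.map Nat.factorial).prod = A at hcard ⊢
  zify at hcard hchoose
  push_cast
  set N : ℤ := (#(univ.filter (fun w : Fin n → Fin 16 => content w = c)) : ℤ)
  set P := pairSum (wordSets (toWord (spell c) n))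
  set B : ℤ := (c.sum.factorial : ℤ)
  set D : ℤ := ((n - c.sum).factorial : ℤ)
  linear_combination (N * (D * A)) * hpair + (n.factorial : ℤ) ^ 2 * wordSum (spell c) * hcard
    - (n.factorial : ℤ) ^ 2 * wordSum (spell c) * hchoose

theorem wordSum_perm {l l' : List ℕ} (hl : ∀ S ∈ l, S < 16) (h : l.Perm l') :
    wordSum l = wordSum l' := by
  have hl' : ∀ S ∈ l', S < 16 := fun S hS => hl S (h.mem_iff.2 hS)
  rw [wordSum, wordSum, ← h.length_eq]
  obtain ⟨σ, hσ⟩ := exists_perm_comp_eq (w := toWord l' l.length) (w' := toWord l l.length)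
    fun S => by rw [card_toWord le_rfl hl, card_toWord h.length_eq.ge hl', h.count_eq, h.length_eq]
  rw [hσ, pairSum_wordSets_comp]

/-- The letter whose binary digits are those of `S` at the positions in the list `g`. -/
def relabel (g : List ℕ) (S : ℕ) : ℕ :=
  (S.testBit (g.getD 0 0)).toNat + 2 * (S.testBit (g.getD 1 0)).toNat
    + 4 * (S.testBit (g.getD 2 0)).toNat + 8 * (S.testBit (g.getD 3 0)).toNat

/-- The permutations of `{0, 1, 2, 3}` as lists. -/
def relabelings : List (List ℕ) :=
  [[0, 1, 2, 3], [0, 1, 3, 2], [0, 2, 1, 3], [0, 2, 3, 1], [0, 3, 1, 2], [0, 3, 2, 1],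
    [1, 0, 2, 3], [1, 0, 3, 2], [1, 2, 0, 3], [1, 2, 3, 0], [1, 3, 0, 2], [1, 3, 2, 0],
    [2, 0, 1, 3], [2, 0, 3, 1], [2, 1, 0, 3], [2, 1, 3, 0], [2, 3, 0, 1], [2, 3, 1, 0],
    [3, 0, 1, 2], [3, 0, 2, 1], [3, 1, 0, 2], [3, 1, 2, 0], [3, 2, 0, 1], [3, 2, 1, 0]]

theorem exists_perm_of_mem_relabelings : ∀ g ∈ relabelings, ∃ τ : Perm (Fin 4),
    ∀ j : Fin 4, ((τ j : Fin 4) : ℕ) = g.getD j 0 := by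
  decide +kernel

theorem relabel_lt (g : List ℕ) (S : ℕ) : relabel g S < 16 := by
  have h := fun k => Bool.toNat_lt (S.testBit (g.getD k 0))
  have h0 := h 0
  have h1 := h 1
  have h2 := h 2
  have h3 := h 3
  unfold relabel
  omega

theorem testBit_relabel (g : List ℕ) (S : ℕ) (j : Fin 4) :
    (relabel g S).testBit j = S.testBit (g.getD j 0) := by
  have h : ∀ (p q r s : Bool) (j : Fin 4),
      (p.toNat + 2 * q.toNat + 4 * r.toNat + 8 * s.toNat).testBit j = ![p, q, r, s] j := by
    decide +kernel
  rw [relabel, h]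
  fin_cases j <;> rfl

theorem wordSum_map_relabel {g : List ℕ} (hg : g ∈ relabelings) {l : List ℕ}
    (hl : ∀ S ∈ l, S < 16) : wordSum (l.map (relabel g)) = wordSum l := by
  obtain ⟨τ, hτ⟩ := exists_perm_of_mem_relabelings g hg
  rw [wordSum, wordSum, List.length_map, ← pairSum_comp τ (wordSets (toWord l l.length))]
  congr 1
  ext j i
  rw [Function.comp_apply, mem_wordSets, mem_wordSets, toWord, toWord,
    List.getD_eq_getElem _ _ (by rw [List.length_map]; exact i.2), List.getD_eq_getElem _ _ i.2,
    List.getElem_map, Fin.val_ofNat, Fin.val_ofNat, Nat.mod_eq_of_lt (relabel_lt _ _),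
    Nat.mod_eq_of_lt (hl _ (List.getElem_mem _)), testBit_relabel, hτ]

/-- The last `k` hexadecimal digits of a number, the least significant one first. -/
def hexDigits : ℕ → ℕ → List ℕ
  | 0, _ => []
  | k + 1, x => x % 16 :: hexDigits k (x / 16)

theorem hexDigits_sum (k : ℕ) {a : ℕ → ℕ} (ha : ∀ S, a S < 16) :
    hexDigits k (∑ S ∈ range k, a S * 16 ^ S) = (List.range k).map a := by
  induction k generalizing a with
  | zero => rfl
  | succ k ih =>
    have hsum : ∑ S ∈ range (k + 1), a S * 16 ^ S
        = 16 * ∑ S ∈ range k, a (S + 1) * 16 ^ S + a 0 := by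
      rw [sum_range_succ', mul_sum, pow_zero, mul_one]
      congr 1
      exact sum_congr rfl fun S _ => by ring
    rw [hsum, hexDigits, List.range_succ_eq_map, List.map_cons, List.map_map]
    have h0 := ha 0
    rw [show (16 * ∑ S ∈ range k, a (S + 1) * 16 ^ S + a 0) / 16
      = ∑ S ∈ range k, a (S + 1) * 16 ^ S by omega, ih fun S => ha (S + 1)]
    congr 1
    omega

/-- The list with the numbers of occurrences of `0, …, 15` given by hexadecimal digits. -/
def decode (x : ℕ) : List ℕ := spellFrom 0 (hexDigits 16 x)

/-- The number whose hexadecimal digits are the numbers of occurrences of `0, …, 15`. -/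
def encode (l : List ℕ) : ℕ := (l.map (16 ^ ·)).sum

theorem encode_eq_sum {l : List ℕ} (hl : ∀ S ∈ l, S < 16) :
    encode l = ∑ S ∈ range 16, l.count S * 16 ^ S := by
  rw [encode, sum_list_map_count]
  refine sum_subset (fun S hS => mem_range.2 (hl S (List.mem_toFinset.1 hS))) fun S _ hS => ?_
  rw [List.count_eq_zero_of_not_mem fun h => hS (List.mem_toFinset.2 h), zero_smul]

theorem perm_decode_encode {l : List ℕ} (hl : ∀ S ∈ l, S < 16) (hlen : l.length < 16) :
    l.Perm (decode (encode l)) := by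
  refine List.perm_iff_count.2 fun T => ?_
  rw [decode, encode_eq_sum hl,
    hexDigits_sum 16 (fun S => (List.count_le_length).trans_lt hlen)]
  have h := (count_spellFrom 0 ((List.range 16).map fun S => l.count S) T).1
  rw [zero_add] at h
  rw [h]
  rcases lt_or_ge T 16 with hT | hT
  · rw [List.getD_eq_getElem _ _ (by simpa using hT)]
    simp
  · rw [List.getD_eq_default _ _ (by simpa using hT)]
    exact List.count_eq_zero_of_not_mem fun h => (hl T h).not_ge hT

/-- The sum of the products of corresponding entries of two lists. -/
noncomputable def dot (l : List ℕ) : List ℕ → ℕ :=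
  List.rec (fun _ => 0) (fun a _ ih l' =>
    List.rec 0 (fun b bs _ => Nat.add (Nat.mul a b) (ih bs)) l') l

theorem dot_cons_cons (a b : ℕ) (l l' : List ℕ) : dot (a :: l) (b :: l') = a * b + dot l l' := rfl

theorem sum_map_spellFrom (f : ℕ → ℕ) (k : ℕ) (c : List ℕ) :
    ((spellFrom k c).map f).sum = dot c ((List.range c.length).map fun S => f (k + S)) := by
  induction c generalizing k with
  | nil => rfl
  | cons m c ih =>
    rw [spellFrom, List.map_append, List.sum_append, ih, List.map_replicate, List.sum_replicate,
      List.length_cons, List.range_succ_eq_map, List.map_cons, List.map_map, dot_cons_cons,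
      smul_eq_mul,
      add_zero, add_comm]
    congr 3
    funext S
    simp only [Function.comp_apply, Nat.succ_eq_add_one]
    congr 1
    omega

/-- The weights for which `dot` gives the code of a relabeled word with given content. -/
def relabelWeights (g : List ℕ) : List ℕ := (List.range 15).map fun S => 16 ^ relabel g (1 + S)

theorem dot_relabelWeights {c : List ℕ} (hc : c.length = 15) (g : List ℕ) :
    dot c (relabelWeights g) = encode ((spell c).map (relabel g)) := by
  rw [encode, List.map_map, spell, sum_map_spellFrom, hc]
  rfl

/-- The largest of `m` and the codes of the relabelings of a word with given content. -/
noncomputable def topCode (W : List (List ℕ)) (c : List ℕ) : ℕ → ℕ :=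
  List.rec (fun m => m)
    (fun w _ ih m => force (dot c w) fun x => bif Nat.ble m x then ih x else ih m) W

theorem topCode_cons (w : List ℕ) (W : List (List ℕ)) (c : List ℕ) (m : ℕ) : topCode (w :: W) c m
    = bif Nat.ble m (dot c w) then topCode W c (dot c w) else topCode W c m :=
  force_eq (dot c w) fun x => bif Nat.ble m x then topCode W c x else topCode W c m

theorem topCode_mem (W : List (List ℕ)) (c : List ℕ) (m : ℕ) :
    topCode W c m = m ∨ topCode W c m ∈ W.map (dot c) := by
  induction W generalizing m with
  | nil => exact Or.inl rfl
  | cons w W ih =>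
    rw [topCode_cons, List.map_cons, List.mem_cons]
    cases Nat.ble m (dot c w) with
    | true => exact Or.inr (ih (dot c w))
    | false => exact (ih m).imp_right Or.inr

theorem topCode_zero_mem {W : List (List ℕ)} (hW : W ≠ []) (c : List ℕ) :
    topCode W c 0 ∈ W.map (dot c) := by
  obtain ⟨w, W, rfl⟩ := List.exists_cons_of_ne_nil hW
  rw [topCode_cons, List.map_cons, List.mem_cons, Nat.ble_eq_true_of_le (Nat.zero_le _)]
  exact topCode_mem W c (dot c w)

theorem wordSum_spell_eq {c : List ℕ} (hc : c.length = 15) (hsum : c.sum < 16) :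
    wordSum (spell c) = wordSum (decode (topCode (relabelings.map relabelWeights) c 0)) := by
  have hmem : topCode (relabelings.map relabelWeights) c 0
      ∈ (relabelings.map relabelWeights).map (dot c) := topCode_zero_mem (by simp [relabelings]) c
  simp only [List.mem_map, exists_exists_and_eq_and] at hmem
  obtain ⟨g, hg, h⟩ := hmem
  have hlt : ∀ S ∈ (spell c).map (relabel g), S < 16 := fun S hS => by
    obtain ⟨T, -, rfl⟩ := List.mem_map.1 hS
    exact relabel_lt g T
  rw [← wordSum_map_relabel hg fun S hS => lt_of_mem_spell hc hS, ← h, dot_relabelWeights hc]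
  exact wordSum_perm hlt
    (perm_decode_encode hlt (by rwa [List.length_map, length_spell]))

/-- The value attached to a code in a table. -/
def lookup : List (ℕ × ℕ) → ℕ → Option ℕ
  | [], _ => none
  | p :: t, x => bif Nat.beq x p.1 then some p.2 else lookup t x

theorem mem_of_lookup {t : List (ℕ × ℕ)} {x : ℕ} {q : ℕ} (h : lookup t x = some q) :
    (x, q) ∈ t := by
  induction t with
  | nil => simp [lookup] at h
  | cons p t ih =>
    rw [lookup, natBeq_eq_decide] at h
    by_cases hx : x = p.1
    · rw [decide_eq_true hx, cond_true, Option.some.injEq] at h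
      rw [hx, ← h]
      exact List.mem_cons_self
    · rw [decide_eq_false hx, cond_false] at h
      exact List.mem_cons_of_mem _ (ih h)

/-- Whether a table entry gives the value of the word with the given code. -/
noncomputable def entryValid (p : ℕ × ℕ) : Bool :=
  forceList force (decode p.1) fun l =>
    (List.range 4).all (fun j => Nat.beq (members l j).length 4)
      && decide (wordValue l = Int.ofNat p.2)

theorem lt_of_mem_decode {x S : ℕ} (hS : S ∈ decode x) : S < 16 := by
  by_contra h
  have hlen : ∀ k y, (hexDigits k y).length = k := fun k => by
    induction k with
    | zero => intro y; rfl
    | succ k ih => intro y; rw [hexDigits, List.length_cons, ih]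
  have := (count_spellFrom 0 (hexDigits 16 x) S).1
  rw [zero_add, List.getD_eq_default _ _ (by rw [hlen]; omega)] at this
  exact (List.count_pos_iff.2 hS).ne' this

theorem wordSum_of_entryValid {p : ℕ × ℕ} (h : entryValid p = true) :
    wordSum (decode p.1) = (p.2 : ℤ) := by
  rw [entryValid, forceList_eq force_eq, Bool.and_eq_true, decide_eq_true_iff,
    List.all_eq_true] at h
  rw [← Int.ofNat_eq_natCast, ← h.2]
  refine wordSum_eq_wordValue (fun S hS => lt_of_mem_decode hS) fun j hj => ?_
  have := h.1 j (List.mem_range.2 hj)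
  rwa [natBeq_eq_decide, decide_eq_true_iff] at this

/-- The number of positions whose letter has the `j`-th binary digit, for a word with content
`c`. -/
def digitTotal (c : List ℕ) (j : ℕ) : ℕ :=
  ((List.range 15).map fun S => if (S + 1).testBit j then c.getD S 0 else 0).sum

/-- Whether four sets with content `c` have size four and at most two private elements each. -/
def IsBalanced : List ℕ → Bool
  | [x1, x2, x3, x4, x5, x6, x7, x8, x9, x10, x11, x12, x13, x14, x15] =>
    Nat.beq (x1 + x3 + x5 + x7 + x9 + x11 + x13 + x15) 4 && (Nat.ble x1 2
      && (Nat.beq (x2 + x3 + x6 + x7 + x10 + x11 + x14 + x15) 4 && (Nat.ble x2 2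
      && (Nat.beq (x4 + x5 + x6 + x7 + x12 + x13 + x14 + x15) 4 && (Nat.ble x4 2
      && (Nat.beq (x8 + x9 + x10 + x11 + x12 + x13 + x14 + x15) 4 && Nat.ble x8 2))))))
  | _ => false

/-- The balanced contents. -/
noncomputable def contents : List (List ℕ) :=
  (List.range 5).flatMap fun x15 =>
  (List.range (5 - x15)).flatMap fun x14 =>
  (List.range (5 - (x15 + x14))).flatMap fun x13 =>
  (List.range (5 - (x15 + x14 + x13))).flatMap fun x12 =>
  (List.range (5 - (x15 + x14 + x13 + x12))).flatMap fun x11 =>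
  (List.range (5 - (x15 + x14 + x13 + x12 + x11))).flatMap fun x10 =>
  (List.range (min 3 (5 - (x15 + x14 + x13 + x12 + x11 + x10)))).flatMap fun x8 =>
  force (4 - (x15 + x14 + x13 + x12 + x11 + x10 + x8)) fun x9 =>
  force (4 - (x15 + x13 + x11 + x9)) fun r0 =>
  force (4 - (x15 + x14 + x11 + x10)) fun r1 =>
  force (4 - (x15 + x14 + x13 + x12)) fun r2 =>
  (List.range (min r0 (min r1 r2) + 1)).flatMap fun x7 =>
  (List.range (min r1 r2 - x7 + 1)).flatMap fun x6 =>
  (List.range (min 3 (r2 - (x7 + x6) + 1))).flatMap fun x4 =>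
  force (r2 - (x7 + x6 + x4)) fun x5 =>
  (List.range (min (r0 + 1 - (x7 + x5)) (r1 + 1 - (x7 + x6)))).flatMap fun x3 =>
  force (r1 - (x7 + x6 + x3)) fun x2 => force (r0 - (x7 + x5 + x3)) fun x1 =>
    bif Nat.ble x1 2 && Nat.ble x2 2 then
      [[x1, x2, x3, x4, x5, x6, x7, x8, x9, x10, x11, x12, x13, x14, x15]] else []

theorem isBalanced_iff {c : List ℕ} (hc : c.length = 15) :
    IsBalanced c = true ↔ ∀ j, j < 4 → digitTotal c j = 4 ∧ c.getD (2 ^ j - 1) 0 ≤ 2 := by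
  match c, hc with
  | [x1, x2, x3, x4, x5, x6, x7, x8, x9, x10, x11, x12, x13, x14, x15], _ =>
    have h0 : digitTotal [x1, x2, x3, x4, x5, x6, x7, x8, x9, x10, x11, x12, x13, x14, x15] 0
        = x1 + x3 + x5 + x7 + x9 + x11 + x13 + x15 := by
      simp [digitTotal, List.range_succ, Nat.testBit]
      ring
    have h1 : digitTotal [x1, x2, x3, x4, x5, x6, x7, x8, x9, x10, x11, x12, x13, x14, x15] 1
        = x2 + x3 + x6 + x7 + x10 + x11 + x14 + x15 := by
      simp [digitTotal, List.range_succ, Nat.testBit]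
      ring
    have h2 : digitTotal [x1, x2, x3, x4, x5, x6, x7, x8, x9, x10, x11, x12, x13, x14, x15] 2
        = x4 + x5 + x6 + x7 + x12 + x13 + x14 + x15 := by
      simp [digitTotal, List.range_succ, Nat.testBit]
      ring
    have h3 : digitTotal [x1, x2, x3, x4, x5, x6, x7, x8, x9, x10, x11, x12, x13, x14, x15] 3
        = x8 + x9 + x10 + x11 + x12 + x13 + x14 + x15 := by
      simp [digitTotal, List.range_succ, Nat.testBit]
      ring
    simp only [IsBalanced, Bool.and_eq_true, Nat.beq_eq, Nat.ble_eq]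
    rw [← h0, ← h1, ← h2, ← h3]
    refine ⟨fun h j hj => ?_, fun h => ?_⟩
    · obtain ⟨t0, p0, t1, p1, t2, p2, t3, p3⟩ := h
      interval_cases j
      exacts [⟨t0, p0⟩, ⟨t1, p1⟩, ⟨t2, p2⟩, ⟨t3, p3⟩]
    · exact ⟨(h 0 (by decide)).1, (h 0 (by decide)).2, (h 1 (by decide)).1, (h 1 (by decide)).2,
        (h 2 (by decide)).1, (h 2 (by decide)).2, (h 3 (by decide)).1, (h 3 (by decide)).2⟩

theorem mem_contents {c : List ℕ} (hc : c.length = 15) : c ∈ contents ↔ IsBalanced c = true := by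
  match c, hc with
  | [x1, x2, x3, x4, x5, x6, x7, x8, x9, x10, x11, x12, x13, x14, x15], _ =>
    simp only [contents, force_eq, List.mem_flatMap, List.mem_range, Bool.cond_eq_ite,
      List.mem_ite_nil_right, List.mem_singleton, List.cons.injEq, and_true, IsBalanced,
      Bool.and_eq_true, Nat.beq_eq, Nat.ble_eq, lt_min_iff]
    constructor
    · rintro ⟨_, h15, _, h14, _, h13, _, h12, _, h11, _, h10, _, h8, _, h7, _, h6, _, h4, _, h3,
        hle, h1, h2, rfl, rfl, h5, rfl, rfl, rfl, h9, rfl, rfl, rfl, rfl, rfl, rfl⟩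
      simp only [← h9, ← h5] at h7 h3 h1 hle
      have e9 : x15 + x14 + x13 + x12 + x11 + x10 + x8 + x9 = 4 := by
        clear h7 h6 h4 h3 h1 h2 h5 hle
        omega
      clear h15 h14 h13 h12 h11 h10 h9
      obtain ⟨r0, e0⟩ : ∃ r, 4 = x15 + x13 + x11 + x9 + r := Nat.exists_eq_add_of_le (by omega)
      obtain ⟨r1, e1⟩ : ∃ r, 4 = x15 + x14 + x11 + x10 + r := Nat.exists_eq_add_of_le (by omega)
      obtain ⟨r2, e2⟩ : ∃ r, 4 = x15 + x14 + x13 + x12 + r := Nat.exists_eq_add_of_le (by omega)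
      simp only [Nat.sub_eq_of_eq_add' e0, Nat.sub_eq_of_eq_add' e1, Nat.sub_eq_of_eq_add' e2]
        at h7 h6 h5 h4 h3 h2 h1 hle
      omega
    · intro h
      have l8 := h.2.2.2.2.2.2.2
      have e3 := h.2.2.2.2.2.2.1
      have e2 := h.2.2.2.2.1
      have e1 := h.2.2.1
      have e0 := h.1
      have l4 := h.2.2.2.2.2.1
      have l2 := h.2.2.2.1
      have l1 := h.2.1
      clear h
      have h9 : 4 - (x15 + x14 + x13 + x12 + x11 + x10 + x8) = x9 := by omega
      have r0 : 4 - (x15 + x13 + x11 + x9) = x1 + x3 + x5 + x7 := by omega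
      have r1 : 4 - (x15 + x14 + x11 + x10) = x2 + x3 + x6 + x7 := by omega
      have r2 : 4 - (x15 + x14 + x13 + x12) = x4 + x5 + x6 + x7 := by omega
      have h5 : x4 + x5 + x6 + x7 - (x7 + x6 + x4) = x5 := by omega
      have h2 : x2 + x3 + x6 + x7 - (x7 + x6 + x3) = x2 := by omega
      have h1 : x1 + x3 + x5 + x7 - (x7 + x5 + x3) = x1 := by omega
      refine ⟨x15, by omega, x14, by omega, x13, by omega, x12, by omega, x11, by omega, x10,
        by omega, x8, by omega, x7, ?_⟩
      rw [h9, r0, r1, r2]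
      refine ⟨by omega, x6, by omega, x4, by omega, x3, ?_⟩
      rw [h5, h2, h1]
      exact ⟨by omega, ⟨l1, l2⟩, by simp⟩

theorem forall_mem_flatMap {α β : Type*} {l : List α} {f : α → List β} {P : β → Prop}
    (h : ∀ x, ∀ c ∈ f x, P c) : ∀ c ∈ l.flatMap f, P c := fun c hc => by
  obtain ⟨x, -, hx⟩ := List.mem_flatMap.1 hc
  exact h x c hx

theorem nodup_flatMap_range (S : ℕ) {k : ℕ} {f : ℕ → List (List ℕ)}
    (hS : ∀ x, ∀ c ∈ f x, c.getD S 0 = x) (hf : ∀ x, (f x).Nodup) :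
    ((List.range k).flatMap f).Nodup :=
  List.nodup_flatMap.2 ⟨fun x _ => hf x, List.nodup_range.imp fun {x y} hxy c hx hy =>
    hxy ((hS x c hx).symm.trans (hS y c hy))⟩

theorem length_of_mem_contents : ∀ c ∈ contents, c.length = 15 := by
  simp only [contents, force_eq, Bool.cond_eq_ite]
  repeat refine forall_mem_flatMap fun _ => ?_
  intro c hc
  rw [List.mem_ite_nil_right, List.mem_singleton] at hc
  rw [hc.2]
  rfl

theorem nodup_contents : contents.Nodup := by
  simp only [contents, force_eq, Bool.cond_eq_ite]
  refine nodup_flatMap_range 14 (fun _ => ?_) fun _ => nodup_flatMap_range 13 (fun _ => ?_)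
    fun _ => nodup_flatMap_range 12 (fun _ => ?_) fun _ => nodup_flatMap_range 11 (fun _ => ?_)
    fun _ => nodup_flatMap_range 10 (fun _ => ?_) fun _ => nodup_flatMap_range 9 (fun _ => ?_)
    fun _ => nodup_flatMap_range 7 (fun _ => ?_) fun _ => nodup_flatMap_range 6 (fun _ => ?_)
    fun _ => nodup_flatMap_range 5 (fun _ => ?_) fun _ => nodup_flatMap_range 3 (fun _ => ?_)
    fun _ => nodup_flatMap_range 2 (fun _ => ?_) fun _ => List.Nodup.sublist (l₂ := [_])
      (by split_ifs; exacts [List.Sublist.refl _, List.nil_sublist _]) (List.nodup_singleton _)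
  all_goals
    repeat refine forall_mem_flatMap fun _ => ?_
    intro c hc
    rw [List.mem_ite_nil_right, List.mem_singleton] at hc
    rw [hc.2]
    rfl

theorem card_wordSets {n : ℕ} (w : Fin n → Fin 16) (j : Fin 4) :
    #(wordSets w j) = digitTotal (content w) j := by
  have htotal : digitTotal (content w) j = ∑ S : Fin 15,
      if (S.succ : ℕ).testBit j then (content w).getD S 0 else 0 := by
    rw [digitTotal, Fin.sum_univ_def, ← List.map_coe_finRange_eq_range, List.map_map]
    rfl
  rw [htotal, card_eq_sum_card_fiberwise (f := w) (t := univ) fun i _ => mem_coe.2 (mem_univ _),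
    Fin.sum_univ_succ]
  have hfiber : ∀ S : Fin 16, #{i ∈ wordSets w j | w i = S}
      = if (S : ℕ).testBit j then #{i | w i = S} else 0 := fun S => by
    split_ifs with h
    · refine congrArg card (Finset.ext fun i => ?_)
      simp only [mem_filter, mem_wordSets, mem_univ, true_and, and_iff_right_iff_imp]
      rintro rfl
      exact h
    · refine card_eq_zero.2 (filter_eq_empty_iff.2 fun i hi hS => h ?_)
      rw [← hS]
      exact mem_wordSets.1 hi
  simp only [hfiber, getD_content]
  simp

theorem card_private_wordSets {n : ℕ} (w : Fin n → Fin 16) (j : Fin 4) :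
    #{i ∈ wordSets w j | ∀ k, k ≠ j → i ∉ wordSets w k} = (content w).getD (2 ^ (j : ℕ) - 1) 0 := by
  have hj : 2 ^ (j : ℕ) - 1 < 15 := by
    revert j
    decide
  rw [getD_content w ⟨_, hj⟩]
  congr 1
  ext i
  simp only [mem_filter, mem_wordSets, mem_univ, true_and]
  generalize w i = x
  revert x j
  decide

theorem sum_pairSum_eq (n : ℕ) :
    ∑ I ∈ univ.filter (fun I : Fin 4 → Finset (Fin n) => ∀ j, #(I j) = 4), pairSum I
      = ∑ c ∈ contents.toFinset, ∑ w ∈ univ.filter (fun w : Fin n → Fin 16 => content w = c),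
        pairSum (wordSets w) := by
  have hmaps : ∀ w ∈ univ.filter (fun w : Fin n → Fin 16 => content w ∈ contents.toFinset),
      content w ∈ contents.toFinset := fun w hw => (mem_filter.1 hw).2
  have hbal : ∀ w : Fin n → Fin 16, content w ∈ contents.toFinset ↔
      ∀ j, #(wordSets w j) = 4 ∧ #{i ∈ wordSets w j | ∀ k, k ≠ j → i ∉ wordSets w k} ≤ 2 :=
    fun w => by
      rw [List.mem_toFinset, mem_contents (length_content w), isBalanced_iff (length_content w)]
      simp only [card_wordSets, card_private_wordSets]
      exact ⟨fun h j => h j j.2, fun h j hj => h ⟨j, hj⟩⟩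
  trans ∑ w ∈ univ.filter (fun w : Fin n → Fin 16 => content w ∈ contents.toFinset),
    pairSum (wordSets w)
  · rw [sum_filter, ← (wordSets_bijective n).sum_comp, sum_filter]
    refine sum_congr rfl fun w _ => ?_
    by_cases hw : content w ∈ contents.toFinset
    · rw [if_pos hw, if_pos fun j => ((hbal w).1 hw j).1]
    · rw [if_neg hw]
      split_ifs with hcard
      · rw [hbal w] at hw
        push Not at hw
        obtain ⟨j, hj⟩ := hw
        exact pairSum_eq_zero (hcard j) (hj (hcard j))
      · rfl
  · rw [← sum_fiberwise_of_maps_to hmaps]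
    refine sum_congr rfl fun c hc => ?_
    rw [filter_filter]
    refine sum_congr (filter_congr fun w _ => ?_) fun _ _ => rfl
    exact ⟨fun h => h.2, fun h => ⟨h ▸ hc, h⟩⟩

/-- The codes of the words of length four up to relabeling, with their values. -/
def tableFour : List (ℕ × ℕ) :=
  [(4611686018427387904, 3456)]

/-- The codes of the words of length five up to relabeling, with their values. -/
def tableFive : List (ℕ × ℕ) :=
  [(2382404202878996480, 17280), (3530822107858468880, 13824), (3459045988797255680, 62208),
    (1229500290726625280, 3456)]

/-- The codes of the words of length six up to relabeling, with their values. -/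
def tableSix : List (ℕ × ℕ) :=
  [(2378182078228336656, 383616), (2377900671972147456, 186624), (1301540292310077456, 145152),
    (1229500290474967056, 82944), (1229483797784825856, 145152), (148636379890323456, 145152),
    (3459045988797251856, 342144), (2382404202878992656, 93312), (1229764173248864256, 435456),
    (153122387330605056, 331776), (2449958197289549856, 62208), (1297036761403232256, 0),
    (148636380157706256, 0), (2306405959167123456, 2094336), (2306125583703085056, 756864),
    (76860261096493056, 145152)]

/-- The codes of the words of length seven up to relabeling, with their values. -/
def tableSeven : List (ℕ × ℕ) :=
  [(1229483797783842832, 1316736), (1225260642341036032, 4644864), (148636379890319632, 1078272),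
    (148619887215906832, 2052864), (148618856422776832, 2985984), (76860260844834832, 2011392),
    (2378182078228332832, 2239488), (2377900671971164432, 3151872),
    (2306125583703081232, 6873984), (1301540292310073632, 414720), (1297318167659417632, 2446848),
    (1297036761403228432, 1886976), (1229483797800550432, 476928), (1229483797784822032, 2934144),
    (1225542048598204432, 16671744), (1225261673134166032, 5774976),
    (1225260642342015232, 1451520), (220676381741158432, 1679616), (148900262679945232, 4644864),
    (148636379906048032, 393984), (148618856423756032, 1306368), (144396731773100032, 331776),
    (76860260828127232, 3856896), (76843768154693632, 6137856), (76563392690655232, 2571264),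
    (2306405959167119632, 16464384), (1229764173248860432, 3566592),
    (1229482702567186432, 2612736), (1153485554072952832, 21005568),
    (153122387330601232, 2612736), (77124143618732032, 17936640), (76860261096489232, 570240),
    (76562361914232832, 1980288), (2306125583718809632, 2674944), (1229500290458255632, 622080),
    (216172850834313232, 0), (76578790164140032, 1679616), (1153765929536991232, 101606400),
    (3458764518115574032, 5256576), (1153204147832492032, 6998400)]

/-- The codes of the words of length eight up to relabeling, with their values. -/
def tableEight : List (ℕ × ℕ) :=
  [(1229483797783839008, 15593472), (1225261673134162208, 45785088),
    (1225260642341032208, 73965312), (1224979236084843008, 15261696),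
    (148619887215903008, 20901888), (148619887214923808, 19243008),
    (148618856422773008, 32182272), (144396731772117008, 66147840), (76860260844831008, 9621504),
    (76843768153710608, 67972608), (76563392706379808, 28532736), (76563392689672208, 49372416),
    (76562361913249808, 29880576), (72621643504033808, 209309184), (72620612710903808, 158464512),
    (72340237247844608, 61896960), (2306125583702098208, 81616896),
    (1297036761402245408, 22228992), (1225542048598200608, 136028160),
    (1225260642342011408, 10948608), (1225260577916526608, 166800384),
    (1153485554088677408, 64364544), (1153485554072949008, 234503424),
    (1153485554071969808, 263139840), (216172850834309408, 26873856),
    (148900262679941408, 41472000), (148636379889336608, 0), (148618856423752208, 11943936),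
    (148618791998267408, 34297344), (144678138029285408, 130056192),
    (144397762565247008, 67018752), (144396731773096208, 22228992),
    (144115325516907008, 37158912), (144115325515927808, 21233664), (76860260828123408, 37926144),
    (76843768170418208, 23556096), (76843768154689808, 84768768), (76578790179864608, 24551424),
    (76578790164136208, 20362752), (76563392690651408, 155976192), (76562361896542208, 27205632),
    (76562297473015808, 72182016), (72902018968072208, 1040449536), (72620612711883008, 22602240),
    (72340172823339008, 208106496), (2306405959167115808, 132710400),
    (1229764173248856608, 5971968), (1229482702567182608, 25982208),
    (1153765929536987408, 1040449536), (1153204147832488208, 84934656), (153122387330597408, 0),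
    (77124143618728208, 171528192), (76842672937054208, 184654080), (76562361914229008, 82010880),
    (845524442820608, 780420096), (2377900607546655008, 51757056), (1224979171660337408, 8957952),
    (72340237263573008, 71663616), (2306124488485441808, 219189888),
    (1125899906859008, 6502809600), (565148978782208, 727916544), (564118202359808, 201139200),
    (76578790414811408, 1119744)]

/-- The codes of the words of length nine up to relabeling, with their values. -/
def tableNine : List (ℕ × ℕ) :=
  [(1225260642341028384, 370262016), (1153485554071965984, 3450677760),
    (148618856422769184, 53747712), (144396731772113184, 1149603840),
    (144115325515923984, 465813504), (76843768153706784, 1021206528),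
    (76563392689668384, 1260458496), (76563392688689184, 298598400),
    (76562361913245984, 689389056), (76562297472032784, 543822336),
    (72621643504029984, 3200974848), (72621643503050784, 1807266816),
    (72620612710899984, 2899763712), (72340237247840784, 593091072),
    (72340172823335184, 4137640704), (72339206454710784, 656916480),
    (72339206453731584, 1574360064), (72339142029225984, 1212682752),
    (1225260577916522784, 2098027008), (1224979236083859984, 1194393600),
    (1224979171660333584, 510603264), (1153485554072945184, 1266057216),
    (1153204147831505184, 1131687936), (148618791998263584, 262766592),
    (144396731773092384, 173187072), (144396667347607584, 1373925888),
    (76860260828119584, 29859840), (76843768154685984, 173187072), (76578790163153184, 188490240),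
    (76562361896538384, 364290048), (76562297488740384, 223948800),
    (76562297473011984, 1289758464), (72902018968068384, 10534551552),
    (72620612711879184, 531505152), (72620548286394384, 12558488832),
    (72340237263569184, 1263071232), (72340237246861584, 1525837824),
    (72339142030205184, 780088320), (845524458545184, 2270840832), (845524442816784, 10218783744),
    (845524441837584, 15158534400), (565148994506784, 3009871872), (565148978778384, 10846960128),
    (564118201376784, 3309776640), (2306124488485437984, 3272638464),
    (1229482702567178784, 214990848), (1153765929536983584, 10534551552),
    (77124143618724384, 859963392), (76842672937050384, 2112023808),
    (76561202255376384, 1934917632), (1125899906855184, 84276412416),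
    (564118202355984, 2917306368), (144115261091418384, 438939648),
    (1153484458855309584, 14715115776), (1153204083391271184, 5120962560)]

/-- The codes of the words of length ten up to relabeling, with their values. -/
def tableTen : List (ℕ × ℕ) :=
  [(76562297472028960, 8527970304), (72620612710896160, 36166238208),
    (72340237246857760, 13090553856), (72340172823331360, 16796160000),
    (72339206453727760, 38817792000), (72339142029222160, 42916055040),
    (845524441833760, 196730062848), (564118201372960, 75939545088),
    (1224979171659350560, 21212430336), (1153204083391267360, 70779764736),
    (144115325514940960, 6879707136), (144115261091414560, 8432418816),
    (76562361896534560, 4013162496), (76562297473008160, 11469164544),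
    (72620548286390560, 154000631808), (72340172822352160, 100794875904),
    (72339142030201360, 23720656896), (72339077604716560, 118728695808), (72057735773032960, 0),
    (845524442812960, 145333813248), (565148978774560, 31066177536),
    (565148977795360, 236203278336), (564118184665360, 31066177536),
    (1153484458855305760, 218699440128), (76842672937046560, 16458743808),
    (76561202255372560, 20812308480), (1125899906851360, 1053455155200),
    (564118202352160, 27709931520), (564053761138960, 274027484160), (1153204147814793760, 0),
    (76578790146441760, 0), (844429225177360, 1348422598656), (2305843017803760160, 139314069504),
    (282647520678160, 92876046336)]

/-- The codes of the words of length eleven up to relabeling, with their values. -/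
def tableEleven : List (ℕ × ℕ) :=
  [(72339142029218336, 1057898299392), (72339077604712736, 1573840502784), (564118184661536, 0),
    (564053761135136, 7124916142080), (564053760155936, 3124918849536),
    (76561202255368736, 208111140864), (844429225173536, 20394891804672),
    (282647520674336, 2555142340608), (72057671348523536, 0),
    (1153202988173627936, 5202778521600)]

/-- The codes of the words of length twelve up to relabeling, with their values. -/
def tableTwelve : List (ℕ × ℕ) :=
  [(562958543495712, 367108052484096), (282583079457312, 269712038559744)]

/-- `addAt k v a` adds `v` to the `k`-th entry of the list `a`. -/
def addAt : ℕ → ℕ → List ℕ → List ℕ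
  | _, _, [] => []
  | 0, v, x :: a => (x + v) :: a
  | k + 1, v, x :: a => x :: addAt k v a

/-- The number of words with given content. -/
def arrangements (c : List ℕ) : ℕ := c.sum.factorial / (c.map Nat.factorial).prod

/-- Adds the contributions of contents to totals sorted by length, looking values up in tables
sorted by length. -/
noncomputable def tally (W : List (List ℕ)) (t : List (List (ℕ × ℕ))) (L : List (List ℕ)) :
    List ℕ → Option (List ℕ) :=
  List.rec (fun a => some a) (fun c _ ih a =>
    force c.sum fun b => force (topCode W c 0) fun x =>
    (lookup (t.getD b []) x).bind fun q => forceList force (addAt b (arrangements c * q) a) ih) L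

theorem length_addAt (k v : ℕ) (a : List ℕ) : (addAt k v a).length = a.length := by
  induction a generalizing k with
  | nil => simp [addAt]
  | cons x a ih =>
    cases k with
    | zero => rfl
    | succ k => rw [addAt, List.length_cons, ih, List.length_cons]

theorem getD_addAt {k : ℕ} (v : ℕ) {a : List ℕ} (hk : k < a.length) (b : ℕ) :
    (addAt k v a).getD b 0 = a.getD b 0 + if b = k then v else 0 := by
  induction a generalizing k b with
  | nil => exact absurd hk (Nat.not_lt_zero k)
  | cons x a ih =>
    cases k with
    | zero => cases b <;> simp [addAt]
    | succ k =>
      cases b with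
      | zero => simp [addAt]
      | succ b =>
        have := ih (k := k) (Nat.lt_of_succ_lt_succ hk) b
        simpa [addAt] using this

theorem prod_map_factorial_dvd (c : List ℕ) : (c.map Nat.factorial).prod ∣ c.sum.factorial := by
  induction c with
  | nil => exact dvd_rfl
  | cons m c ih =>
    rw [List.map_cons, List.prod_cons, List.sum_cons]
    exact (mul_dvd_mul_left _ ih).trans (Nat.factorial_mul_factorial_dvd_factorial_add m c.sum)

theorem arrangements_mul (c : List ℕ) :
    arrangements c * (c.map Nat.factorial).prod = c.sum.factorial :=
  Nat.div_mul_cancel (prod_map_factorial_dvd c)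

theorem tally_cons (W : List (List ℕ)) (t : List (List (ℕ × ℕ))) (c : List ℕ) (L : List (List ℕ))
    (a : List ℕ) : tally W t (c :: L) a = (lookup (t.getD c.sum []) (topCode W c 0)).bind fun q =>
      tally W t L (addAt c.sum (arrangements c * q) a) := by
  change force c.sum (fun b => force (topCode W c 0) fun x =>
    (lookup (t.getD b []) x).bind fun q =>
      forceList force (addAt b (arrangements c * q) a) (tally W t L)) = _
  simp only [force_eq, forceList_eq force_eq]

theorem sum_of_tally {W : List (List ℕ)} {t : List (List (ℕ × ℕ))} {L : List (List ℕ)}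
    {a a' : List ℕ} (h : tally W t L a = some a') (hL : ∀ c ∈ L, c.sum < a.length)
    {v : List ℕ → ℝ} (hv : ∀ c ∈ L, ∀ q, (topCode W c 0, q) ∈ t.getD c.sum [] → v c = q)
    (f : ℕ → ℝ) : ∑ b ∈ range a.length, f b * a'.getD b 0
      = ∑ b ∈ range a.length, f b * a.getD b 0
        + (L.map fun c => f c.sum * (arrangements c * v c)).sum := by
  induction L generalizing a with
  | nil =>
    obtain rfl : a = a' := Option.some.inj h
    simp
  | cons c L ih =>
    rw [tally_cons] at h
    obtain ⟨q, hq, h⟩ := Option.bind_eq_some_iff.1 h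
    have hc := hL c List.mem_cons_self
    have ih := ih h (fun c' hc' => by
      rw [length_addAt]
      exact hL c' (List.mem_cons_of_mem _ hc')) fun c' hc' => hv c' (List.mem_cons_of_mem _ hc')
    rw [length_addAt] at ih
    rw [ih, List.map_cons, List.sum_cons, ← add_assoc,
      hv c List.mem_cons_self q (mem_of_lookup hq)]
    congr 1
    simp only [getD_addAt _ hc, Nat.cast_add, mul_add, sum_add_distrib, Nat.cast_ite, Nat.cast_zero,
      mul_ite, mul_zero, sum_ite_eq', mem_range, hc, if_true, Nat.cast_mul]

set_option maxRecDepth 100000 in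
theorem entryValid_tableFour : ∀ p ∈ tableFour, entryValid p = true := by
  unfold tableFour
  repeat refine List.forall_mem_cons.2 ⟨by decide +kernel, ?_⟩
  exact List.forall_mem_nil _

set_option maxRecDepth 100000 in
theorem entryValid_tableFive : ∀ p ∈ tableFive, entryValid p = true := by
  unfold tableFive
  repeat refine List.forall_mem_cons.2 ⟨by decide +kernel, ?_⟩
  exact List.forall_mem_nil _

set_option maxRecDepth 100000 in
theorem entryValid_tableSix : ∀ p ∈ tableSix, entryValid p = true := by
  unfold tableSix
  repeat refine List.forall_mem_cons.2 ⟨by decide +kernel, ?_⟩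
  exact List.forall_mem_nil _

set_option maxRecDepth 100000 in
theorem entryValid_tableSeven : ∀ p ∈ tableSeven, entryValid p = true := by
  unfold tableSeven
  repeat refine List.forall_mem_cons.2 ⟨by decide +kernel, ?_⟩
  exact List.forall_mem_nil _

set_option maxRecDepth 100000 in
theorem entryValid_tableEight : ∀ p ∈ tableEight, entryValid p = true := by
  unfold tableEight
  repeat refine List.forall_mem_cons.2 ⟨by decide +kernel, ?_⟩
  exact List.forall_mem_nil _

set_option maxRecDepth 100000 in
theorem entryValid_tableNine : ∀ p ∈ tableNine, entryValid p = true := by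
  unfold tableNine
  repeat refine List.forall_mem_cons.2 ⟨by decide +kernel, ?_⟩
  exact List.forall_mem_nil _

set_option maxRecDepth 100000 in
theorem entryValid_tableTen : ∀ p ∈ tableTen, entryValid p = true := by
  unfold tableTen
  repeat refine List.forall_mem_cons.2 ⟨by decide +kernel, ?_⟩
  exact List.forall_mem_nil _

set_option maxRecDepth 100000 in
theorem entryValid_tableEleven : ∀ p ∈ tableEleven, entryValid p = true := by
  unfold tableEleven
  repeat refine List.forall_mem_cons.2 ⟨by decide +kernel, ?_⟩
  exact List.forall_mem_nil _

set_option maxRecDepth 100000 in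
theorem entryValid_tableTwelve : ∀ p ∈ tableTwelve, entryValid p = true := by
  unfold tableTwelve
  repeat refine List.forall_mem_cons.2 ⟨by decide +kernel, ?_⟩
  exact List.forall_mem_nil _

/-- The tables sorted by length. -/
def tables : List (List (ℕ × ℕ)) :=
  [[], [], [], [], tableFour, tableFive, tableSix, tableSeven, tableEight, tableNine, tableTen,
    tableEleven, tableTwelve]

theorem mem_tables {b : ℕ} {p : ℕ × ℕ} (hp : p ∈ tables.getD b []) : entryValid p = true := by
  have h : ∀ t ∈ tables, ∀ p ∈ t, entryValid p = true := by
    simp only [tables, List.forall_mem_cons]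
    exact ⟨List.forall_mem_nil _, List.forall_mem_nil _, List.forall_mem_nil _,
      List.forall_mem_nil _, entryValid_tableFour, entryValid_tableFive, entryValid_tableSix,
      entryValid_tableSeven, entryValid_tableEight, entryValid_tableNine, entryValid_tableTen,
      entryValid_tableEleven, entryValid_tableTwelve, List.forall_mem_nil _⟩
  rcases lt_or_ge b tables.length with hb | hb
  · rw [List.getD_eq_getElem _ _ hb] at hp
    exact h _ (List.getElem_mem hb) p hp
  · rw [List.getD_eq_default _ _ hb] at hp
    exact absurd hp List.not_mem_nil

set_option maxRecDepth 100000 in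
theorem tally_tables :
    forceList (forceList force) (relabelings.map relabelWeights) (fun W =>
      tally W tables contents (List.replicate 13 0))
    = some [0, 0, 0, 0, 3456, 11473920, 8974748160, 3466795852800, 831844211466240,
        134073995713781760, 14573524652428492800, 990765961921187020800,
        32466343900794480230400] := by
  decide +kernel

theorem sum_le_of_isBalanced {c : List ℕ} (h : IsBalanced c = true) : c.sum ≤ 12 := by
  unfold IsBalanced at h
  split at h
  · simp only [Bool.and_eq_true, Nat.beq_eq, Nat.ble_eq] at h
    simp only [List.sum_cons, List.sum_nil]
    omega
  · exact absurd h Bool.false_ne_true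

theorem sum_wordSum_contents (f : ℕ → ℝ) :
    ∑ c ∈ contents.toFinset, f c.sum * (arrangements c * wordSum (spell c))
      = f 4 * 3456 + f 5 * 11473920 + f 6 * 8974748160 + f 7 * 3466795852800
        + f 8 * 831844211466240 + f 9 * 134073995713781760 + f 10 * 14573524652428492800
        + f 11 * 990765961921187020800 + f 12 * 32466343900794480230400 := by
  have hsum : ∀ c ∈ contents, c.sum ≤ 12 := fun c hc =>
    sum_le_of_isBalanced ((mem_contents (length_of_mem_contents c hc)).1 hc)
  have htally := tally_tables
  rw [forceList_eq fun a k => forceList_eq force_eq a k] at htally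
  have h := sum_of_tally htally (fun c hc => Nat.lt_succ_of_le (hsum c hc))
    (v := fun c => wordSum (spell c)) (fun c hc q hq => by
      rw [wordSum_spell_eq (length_of_mem_contents c hc) ((hsum c hc).trans_lt (by decide)),
        wordSum_of_entryValid (mem_tables hq)]
      exact Int.cast_natCast q) f
  rw [List.sum_toFinset _ nodup_contents]
  simp only [List.length_replicate, sum_range_succ, range_zero, sum_empty] at h
  simp [List.replicate] at h
  linarith

theorem sum_pairSum_content {c : List ℕ} (hc : c.length = 15) (n : ℕ) :
    ((∑ w ∈ univ.filter (fun w : Fin n → Fin 16 => content w = c), pairSum (wordSets w) : ℤ) : ℝ)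
      = (n.factorial : ℝ) ^ 2 * n.choose c.sum / (c.sum.factorial : ℝ) ^ 2
        * (arrangements c * wordSum (spell c)) := by
  have h := congrArg (fun x : ℤ => (x : ℝ)) (sum_pairSum_of_content hc n)
  push_cast only [Int.cast_mul, Int.cast_natCast, Int.cast_pow] at h
  have harr : (arrangements c : ℝ) * ((c.map Nat.factorial).prod : ℕ) = c.sum.factorial := by
    exact_mod_cast arrangements_mul c
  have hfac : (c.sum.factorial : ℝ) ≠ 0 := Nat.cast_ne_zero.2 (Nat.factorial_ne_zero _)
  rw [div_mul_eq_mul_div, eq_div_iff (pow_ne_zero 2 hfac)]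
  linear_combination (arrangements c : ℝ) * h
    - (c.sum.factorial : ℝ) * ((∑ w ∈ univ.filter (fun w : Fin n → Fin 16 => content w = c),
      pairSum (wordSets w) : ℤ) : ℝ) * harr

/-- Exact fourth null moment of `K_n = 3 Σ_{|I|=4} ψ_{τ*}(pat_I(π))`
in the binomial basis.  `pat k π I` is the rank pattern of `π` on the 4-element
subset `I` (characterized by `hpat`). -/
theorem stmt18
    (B : (Fin 4 → ℝ) → Perm (Fin 4) → ℝ)
    (hB : ∀ u ω, B u ω =
        (if max (u (ω 0)) (u (ω 2)) < min (u (ω 1)) (u (ω 3)) then (1 : ℝ) else 0)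
      + (if max (u (ω 1)) (u (ω 3)) < min (u (ω 0)) (u (ω 2)) then (1 : ℝ) else 0)
      - (if max (u (ω 0)) (u (ω 3)) < min (u (ω 1)) (u (ω 2)) then (1 : ℝ) else 0)
      - (if max (u (ω 1)) (u (ω 2)) < min (u (ω 0)) (u (ω 3)) then (1 : ℝ) else 0))
    (vec : Perm (Fin 4) → Fin 4 → ℝ)
    (hvec : ∀ σ i, vec σ i = ((σ i).val : ℝ) + 1)
    (e : Fin 4 → ℝ) (he : ∀ i, e i = ((i : ℕ) : ℝ) + 1)
    (ψ : Perm (Fin 4) → ℝ)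
    (hψ : ∀ σ, ψ σ = (1 / 24) * ∑ ω : Perm (Fin 4), B e ω * B (vec σ) ω)
    (pat : ∀ (k : ℕ), Perm (Fin k) → Finset (Fin k) → Perm (Fin 4))
    (hpat : ∀ (k : ℕ) (π : Perm (Fin k)) (I : Finset (Fin k)) (h : I.card = 4)
        (a b : Fin 4),
        pat k π I a < pat k π I b ↔
          π ((I.orderIsoOfFin h a : Fin k)) < π ((I.orderIsoOfFin h b : Fin k)))
    (n : ℕ) (hn : 4 ≤ n)
    (K : Perm (Fin n) → ℝ)
    (hK : ∀ π, K π = 3 * ∑ I ∈ Finset.univ.filter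
        (fun I : Finset (Fin n) => I.card = 4), ψ (pat n π I)) :
    (1 / (n.factorial : ℝ)) * ∑ π : Perm (Fin n), (K π) ^ 4
      = 6 * (n.choose 4 : ℝ) + (3984 / 5) * (n.choose 5 : ℝ)
        + (86562 / 5) * (n.choose 6 : ℝ) + (955356 / 7) * (n.choose 7 : ℝ)
        + (35817807 / 70) * (n.choose 8 : ℝ) + (71271603 / 70) * (n.choose 9 : ℝ)
        + (193676346 / 175) * (n.choose 10 : ℝ) + (108817236 / 175) * (n.choose 11 : ℝ)
        + (24762672 / 175) * (n.choose 12 : ℝ) := by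
  have hfac : (n.factorial : ℝ) ≠ 0 := Nat.cast_ne_zero.2 (Nat.factorial_ne_zero n)
  have hmoment := congrArg (fun x : ℤ => (x : ℝ))
    ((factorial_mul_sum_pow_four n).trans (sum_pairSum_eq n))
  simp only [Int.cast_mul, Int.cast_natCast, Int.cast_sum, Int.cast_pow] at hmoment
  have hK' : ∀ π, K π = ∑ I ∈ univ.filter (fun I : Finset (Fin n) => #I = 4),
      ((sim (1 : Perm (Fin n)) π I : ℤ) : ℝ) := fun π => by
    rw [hK, sum_kernel_eq_sum_sim B hB vec hvec e he ψ hψ (pat n) (hpat n) π, Int.cast_sum]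
  simp only [← hK'] at hmoment
  have hterm : ∀ c ∈ contents.toFinset,
      ∑ w ∈ univ.filter (fun w : Fin n → Fin 16 => content w = c), (pairSum (wordSets w) : ℝ)
        = (n.factorial : ℝ) ^ 2 * n.choose c.sum / (c.sum.factorial : ℝ) ^ 2
          * (arrangements c * wordSum (spell c)) := fun c hc => by
    rw [← sum_pairSum_content (length_of_mem_contents c (List.mem_toFinset.1 hc)), Int.cast_sum]
  rw [sum_congr rfl hterm, sum_wordSum_contents fun b =>
    (n.factorial : ℝ) ^ 2 * n.choose b / (b.factorial : ℝ) ^ 2] at hmoment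
  simp only [Nat.factorial] at hmoment
  rw [one_div, inv_mul_eq_iff_eq_mul₀ hfac]
  refine mul_left_cancel₀ hfac (hmoment.trans ?_)
  push_cast
  ring
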